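/- Suppose log n ≪ d = p(n−1) = o(n), let i ≥ 1 be the largest integer such that d^i = o(n), let c = d^{i+1}/n with c − 2 log n → ∞, and let η = log_n(d^i). Let ε = ε(n) → 0 be such that (d/log n)^{−1/2} = o(ε), d/n = o(ε) and ε ≫ (log log n)/(log n), and set r = (η − ε) n log n / d^i. Then asymptotically almost surely, in G ∈ G(n,p), for every set R ⊆ V with |R| = r there exist at least two distinct vertices each at graph distance exactly i+1 from every vertex of R; in particular no such R is a resolving set. -/

import Mathlib

open Filter Real Asymptotics
open scoped Topology

/-- `R` is a resolving set of the graph `G`: every pair of distinct vertices is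
distinguished by its distances to some vertex of `R`. -/
def Resolves {V : Type*} (G : SimpleGraph V) (R : Set V) : Prop :=
  ∀ ⦃v w : V⦄, v ≠ w → ∃ u ∈ R, G.dist u v ≠ G.dist u w

/-- The metric dimension of a graph `G`: the smallest cardinality of a resolving set. -/
noncomputable def metricDim {V : Type*} (G : SimpleGraph V) : ℕ :=
  sInf {k : ℕ | ∃ R : Set V, R.Finite ∧ R.ncard = k ∧ Resolves G R}

/-- The `G(n,p)` probability weight of a single graph on `Fin n`. -/
noncomputable def gnpWeight (n : ℕ) (p : ℝ) (G : SimpleGraph (Fin n)) : ℝ :=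
  p ^ Nat.card G.edgeSet * (1 - p) ^ (n.choose 2 - Nat.card G.edgeSet)

/-- The probability of an event `A` under the binomial random graph `G(n,p)`. -/
noncomputable def gnpProb (n : ℕ) (p : ℝ) (A : Set (SimpleGraph (Fin n))) : ℝ :=
  ∑' G : SimpleGraph (Fin n), A.indicator (gnpWeight n p) G

/-- `S(v,i)`: the set of vertices at graph distance exactly `i` from `v`. -/
def gSphere {V : Type*} (G : SimpleGraph V) (v : V) (i : ℕ) : Set V :=
  {u | G.Reachable v u ∧ G.dist v u = i}

/-- `N(v,i)`: the set of vertices at graph distance at most `i` from `v`. -/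
def gBall {V : Type*} (G : SimpleGraph V) (v : V) (i : ℕ) : Set V :=
  {u | G.Reachable v u ∧ G.dist v u ≤ i}

/-- `S(V',i)`: union of the spheres around the vertices of `V'`. -/
def gSphereSet {V : Type*} (G : SimpleGraph V) (W : Set V) (i : ℕ) : Set V :=
  ⋃ v ∈ W, gSphere G v i

/-- `N(V',i)`: union of the balls around the vertices of `V'`. -/
def gBallSet {V : Type*} (G : SimpleGraph V) (W : Set V) (i : ℕ) : Set V :=
  ⋃ v ∈ W, gBall G v i

section BernoulliProduct

variable {E : Type*} [Fintype E]

/-- The weight of `ω` when every coordinate is independently `true` with probability `p`. -/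
noncomputable def bernWeight (p : ℝ) (ω : E → Bool) : ℝ :=
  ∏ e, if ω e then p else 1 - p

theorem bernWeight_nonneg {p : ℝ} (h0 : 0 ≤ p) (h1 : p ≤ 1) (ω : E → Bool) :
    0 ≤ bernWeight p ω := by
  refine Finset.prod_nonneg fun e _ => ?_
  split_ifs <;> linarith

/-- Expectation under the product of Bernoulli distributions. -/
noncomputable def bernExp [DecidableEq E] (p : ℝ) (f : (E → Bool) → ℝ) : ℝ :=
  ∑ ω, bernWeight p ω * f ω

/-- Probability under the product of Bernoulli distributions. -/
noncomputable def bernProb [DecidableEq E] (p : ℝ) (A : Set (E → Bool)) : ℝ :=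
  bernExp p (A.indicator 1)

variable [DecidableEq E]

theorem bernExp_prod (p : ℝ) (h : E → Bool → ℝ) :
    bernExp p (fun ω => ∏ e, h e (ω e)) = ∏ e, (p * h e true + (1 - p) * h e false) := by
  have : ∀ e, p * h e true + (1 - p) * h e false
      = ∑ b : Bool, (if b then p else 1 - p) * h e b := by
    intro e; simp
  simp only [this, bernExp, bernWeight, Fintype.prod_sum, ← Finset.prod_mul_distrib]

theorem bernExp_const (p a : ℝ) : bernExp p (fun _ : E → Bool => a) = a := by
  have h := bernExp_prod (E := E) p (fun _ _ => 1)
  simp only [Finset.prod_const_one, mul_one, add_sub_cancel] at h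
  have h2 : bernExp p (fun _ : E → Bool => a) = a * bernExp p (fun _ : E → Bool => (1 : ℝ)) := by
    simp only [bernExp, Finset.mul_sum]
    exact Finset.sum_congr rfl fun _ _ => by ring
  rw [h2, h, mul_one]

theorem bernExp_mono {p : ℝ} (h0 : 0 ≤ p) (h1 : p ≤ 1) {f g : (E → Bool) → ℝ}
    (h : ∀ ω, f ω ≤ g ω) : bernExp p f ≤ bernExp p g :=
  Finset.sum_le_sum fun ω _ => mul_le_mul_of_nonneg_left (h ω) (bernWeight_nonneg h0 h1 ω)

theorem bernExp_sum {ι : Type*} (p : ℝ) (s : Finset ι) (f : ι → (E → Bool) → ℝ) :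
    bernExp p (fun ω => ∑ j ∈ s, f j ω) = ∑ j ∈ s, bernExp p (f j) := by
  simp only [bernExp, Finset.mul_sum]
  exact Finset.sum_comm

theorem bernExp_const_mul (p a : ℝ) (f : (E → Bool) → ℝ) :
    bernExp p (fun ω => a * f ω) = a * bernExp p f := by
  simp only [bernExp, Finset.mul_sum]
  exact Finset.sum_congr rfl fun _ _ => by ring

theorem bernProb_nonneg {p : ℝ} (h0 : 0 ≤ p) (h1 : p ≤ 1) (A : Set (E → Bool)) :
    0 ≤ bernProb p A :=
  Finset.sum_nonneg fun ω _ => mul_nonneg (bernWeight_nonneg h0 h1 ω)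
    (Set.indicator_nonneg (fun _ _ => zero_le_one) ω)

theorem bernProb_mono {p : ℝ} (h0 : 0 ≤ p) (h1 : p ≤ 1) {A B : Set (E → Bool)}
    (h : A ⊆ B) : bernProb p A ≤ bernProb p B :=
  bernExp_mono h0 h1 fun ω => Set.indicator_le_indicator_of_subset h (fun _ => zero_le_one) ω

theorem bernProb_compl (p : ℝ) (A : Set (E → Bool)) :
    bernProb p A = 1 - bernProb p Aᶜ := by
  rw [eq_sub_iff_add_eq, ← bernExp_const (E := E) p 1]
  simp only [bernProb, bernExp, ← Finset.sum_add_distrib, ← mul_add]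
  refine Finset.sum_congr rfl fun ω _ => ?_
  by_cases h : ω ∈ A <;> simp [h]

theorem bernProb_le_one {p : ℝ} (h0 : 0 ≤ p) (h1 : p ≤ 1) (A : Set (E → Bool)) :
    bernProb p A ≤ 1 := by
  rw [bernProb_compl]
  linarith [bernProb_nonneg h0 h1 Aᶜ]

theorem bernProb_union_le {p : ℝ} (h0 : 0 ≤ p) (h1 : p ≤ 1) (A B : Set (E → Bool)) :
    bernProb p (A ∪ B) ≤ bernProb p A + bernProb p B := by
  simp only [bernProb, bernExp, ← Finset.sum_add_distrib, ← mul_add]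
  refine Finset.sum_le_sum fun ω _ => mul_le_mul_of_nonneg_left ?_ (bernWeight_nonneg h0 h1 ω)
  by_cases hA : ω ∈ A <;> by_cases hB : ω ∈ B <;> simp [hA, hB]

theorem bernProb_biUnion_le {ι : Type*} {p : ℝ} (h0 : 0 ≤ p) (h1 : p ≤ 1) (s : Finset ι)
    (A : ι → Set (E → Bool)) {b : ℝ} (hb : ∀ j ∈ s, bernProb p (A j) ≤ b) :
    bernProb p (⋃ j ∈ s, A j) ≤ s.card * b := by
  have : bernProb p (⋃ j ∈ s, A j) ≤ ∑ j ∈ s, bernProb p (A j) := by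
    simp only [bernProb]
    rw [← bernExp_sum]
    refine bernExp_mono h0 h1 fun ω => ?_
    refine Set.indicator_apply_le' (fun h => ?_) fun _ =>
      Finset.sum_nonneg fun j _ => Set.indicator_nonneg (fun _ _ => zero_le_one) ω
    simp only [Set.mem_iUnion] at h
    obtain ⟨j, hj, hω⟩ := h
    calc (1 : ℝ) = (A j).indicator 1 ω := by simp [hω]
      _ ≤ _ := Finset.single_le_sum (f := fun j => (A j).indicator (1 : (E → Bool) → ℝ) ω)
        (fun j _ => Set.indicator_nonneg (fun _ _ => zero_le_one) ω) hj
  refine this.trans ((Finset.sum_le_card_nsmul s _ b hb).trans ?_)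
  simp

theorem bernProb_le_of_exp {p : ℝ} (h0 : 0 ≤ p) (h1 : p ≤ 1) {A : Set (E → Bool)}
    {f : (E → Bool) → ℝ} (hf : ∀ ω, 0 ≤ f ω) (hA : ∀ ω ∈ A, 1 ≤ f ω) :
    bernProb p A ≤ bernExp p f :=
  bernExp_mono h0 h1 fun ω => Set.indicator_apply_le' (fun h => hA ω h) fun _ => hf ω

theorem bernExp_mul_of_dependsOn (p : ℝ) {f g : (E → Bool) → ℝ} {S T : Set E}
    (hf : DependsOn f S) (hg : DependsOn g T) (hST : Disjoint S T) :
    bernExp p (fun ω => f ω * g ω) = bernExp p f * bernExp p g := by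
  classical
  let σ : (E → Bool) × (E → Bool) → (E → Bool) × (E → Bool) :=
    fun x => (S.piecewise x.1 x.2, S.piecewise x.2 x.1)
  have hσ : Function.Involutive σ := by
    rintro ⟨a, b⟩
    ext e <;> by_cases he : e ∈ S <;> simp [σ, Set.piecewise, he]
  have hw : ∀ x, bernWeight p (σ x).1 * bernWeight p (σ x).2
      = bernWeight p x.1 * bernWeight p x.2 := by
    rintro ⟨a, b⟩
    simp only [bernWeight, ← Finset.prod_mul_distrib]
    refine Finset.prod_congr rfl fun e _ => ?_
    by_cases he : e ∈ S <;> simp [σ, Set.piecewise, he, mul_comm]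
  have hfg : ∀ x, f (σ x).1 * g (σ x).2 = f x.1 * g x.1 := by
    rintro ⟨a, b⟩
    congr 1
    · exact hf fun e he => by simp [σ, Set.piecewise, he]
    · refine hg fun e he => ?_
      have : e ∉ S := fun h => Set.disjoint_left.mp hST h he
      simp [σ, Set.piecewise, this]
  have key : bernExp p f * bernExp p g
      = ∑ x : (E → Bool) × (E → Bool), (bernWeight p x.1 * bernWeight p x.2) *
        (f x.1 * g x.2) := by
    rw [bernExp, bernExp, Finset.sum_mul_sum, ← Finset.univ_product_univ, Finset.sum_product]
    exact Finset.sum_congr rfl fun _ _ => Finset.sum_congr rfl fun _ _ => by ring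
  rw [key, ← Equiv.sum_comp hσ.toPerm]
  simp only [Function.Involutive.coe_toPerm, hw, hfg]
  rw [← Finset.univ_product_univ, Finset.sum_product]
  have h1 : ∑ ω : E → Bool, bernWeight p ω = 1 := by
    simpa [bernExp] using bernExp_const (E := E) p 1
  refine Finset.sum_congr rfl fun a _ => ?_
  calc _ = bernWeight p a * (f a * g a) * ∑ ω : E → Bool, bernWeight p ω := by rw [h1, mul_one]
    _ = _ := by
      rw [Finset.mul_sum]
      exact Finset.sum_congr rfl fun _ _ => by ring

theorem bernExp_prod_of_dependsOn {ι : Type*} (p : ℝ) (W : Finset ι)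
    (f : ι → (E → Bool) → ℝ) (S : ι → Set E) (hf : ∀ w ∈ W, DependsOn (f w) (S w))
    (hS : (W : Set ι).PairwiseDisjoint S) :
    bernExp p (fun ω => ∏ w ∈ W, f w ω) = ∏ w ∈ W, bernExp p (f w) := by
  classical
  induction W using Finset.induction_on with
  | empty => simpa using bernExp_const (E := E) p 1
  | insert a W ha ih =>
    simp only [Finset.prod_insert ha]
    rw [← ih (fun w hw => hf w (Finset.mem_insert_of_mem hw))
      (hS.subset (by simp))]
    refine bernExp_mul_of_dependsOn p (T := ⋃ w ∈ W, S w) (hf a (Finset.mem_insert_self a W)) ?_ ?_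
    · intro x y hxy
      refine Finset.prod_congr rfl fun w hw => hf w (Finset.mem_insert_of_mem hw) fun e he => ?_
      exact hxy e (Set.mem_biUnion hw he)
    · rw [Set.disjoint_iUnion₂_right]
      intro w hw
      exact hS (by simp) (by simp [hw]) (by rintro rfl; exact ha hw)

theorem bernProb_forall_false (p : ℝ) (S : Finset E) :
    bernProb p {ω | ∀ e ∈ S, ω e = false} = (1 - p) ^ S.card := by
  have h := bernExp_prod (E := E) p (fun e b => if e ∈ S then (if b then 0 else 1) else 1)
  have h2 : ∀ e, p * (if e ∈ S then (if true then (0 : ℝ) else 1) else 1)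
      + (1 - p) * (if e ∈ S then (if false then (0 : ℝ) else 1) else 1)
      = if e ∈ S then 1 - p else 1 := by
    intro e; split_ifs <;> simp_all
  rw [Finset.prod_congr rfl fun e _ => h2 e, Finset.prod_ite_mem, Finset.univ_inter,
    Finset.prod_const] at h
  rw [← h, bernProb]
  congr 1
  ext ω
  by_cases hω : ∀ e ∈ S, ω e = false
  · rw [Set.indicator_of_mem (by exact hω), Pi.one_apply, Finset.prod_eq_one]
    intro e _
    by_cases he : e ∈ S <;> simp [he, hω]
  · rw [Set.indicator_of_notMem (by exact hω)]
    push Not at hω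
    obtain ⟨e, he, hb⟩ := hω
    exact (Finset.prod_eq_zero (Finset.mem_univ e) (by simp_all)).symm

open scoped Classical in
/-- The number of the events `Z w`, `w ∈ W`, that contain `ω`. -/
noncomputable def countEvents {ι Ω : Type*} (W : Finset ι) (Z : ι → Set Ω) (ω : Ω) : ℕ :=
  (W.filter fun w => ω ∈ Z w).card

theorem bernExp_exp_countEvents_le {ι : Type*} {p : ℝ} (h0 : 0 ≤ p) (h1 : p ≤ 1)
    (W : Finset ι) (Z : ι → Set (E → Bool)) (S : ι → Set E)
    (hZ : ∀ w ∈ W, DependsOn (fun ω => ω ∈ Z w) (S w))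
    (hS : (W : Set ι).PairwiseDisjoint S) (t : ℝ) :
    bernExp p (fun ω => exp (t * countEvents W Z ω))
      ≤ exp ((∑ w ∈ W, bernProb p (Z w)) * (exp t - 1)) := by
  classical
  let f : ι → (E → Bool) → ℝ := fun w ω => 1 + (exp t - 1) * (Z w).indicator 1 ω
  have hf : ∀ w ∈ W, DependsOn (f w) (S w) := by
    intro w hw x y hxy
    have := hZ w hw hxy
    simp only [eq_iff_iff] at this
    simp only [f, Set.indicator_apply, this, Pi.one_apply]
  have h2 : ∀ ω, exp (t * countEvents W Z ω) = ∏ w ∈ W, f w ω := by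
    intro ω
    rw [countEvents, mul_comm, Real.exp_nat_mul, ← Finset.prod_const, Finset.prod_filter]
    refine Finset.prod_congr rfl fun w _ => ?_
    by_cases h : ω ∈ Z w <;> simp [f, h]
  simp only [h2]
  rw [bernExp_prod_of_dependsOn p W f S hf hS, Finset.sum_mul, Real.exp_sum]
  refine Finset.prod_le_prod (fun w _ => ?_) fun w _ => ?_
  · refine (bernExp_const (E := E) p 0).symm.le.trans (bernExp_mono h0 h1 fun ω => ?_)
    by_cases h : ω ∈ Z w <;> simp [f, h, Real.exp_nonneg]
  · have : bernExp p (f w) = bernExp p (fun _ : E → Bool => (1 : ℝ))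
        + (exp t - 1) * bernProb p (Z w) := by
      rw [bernProb, ← bernExp_const_mul]
      simp only [bernExp, ← Finset.sum_add_distrib, ← mul_add, f]
    rw [this, bernExp_const]
    linarith [Real.add_one_le_exp (bernProb p (Z w) * (exp t - 1))]

theorem exp_neg_le_quadratic {s : ℝ} (hs : 0 ≤ s) : exp (-s) ≤ 1 - s + s ^ 2 / 2 := by
  have h := Real.quadratic_le_exp_of_nonneg hs
  rw [Real.exp_neg, inv_le_iff_one_le_mul₀ (Real.exp_pos s)]
  nlinarith [mul_le_mul_of_nonneg_left h (by nlinarith [sq_nonneg (s - 1)] :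
    0 ≤ 1 - s + s ^ 2 / 2), sq_nonneg (s ^ 2)]

/-- Chernoff bound, lower tail. -/
theorem bernProb_countEvents_lower {ι : Type*} {p : ℝ} (h0 : 0 ≤ p) (h1 : p ≤ 1)
    (W : Finset ι) (Z : ι → Set (E → Bool)) (S : ι → Set E)
    (hZ : ∀ w ∈ W, DependsOn (fun ω => ω ∈ Z w) (S w))
    (hS : (W : Set ι).PairwiseDisjoint S) {μ δ : ℝ} (hδ : 0 ≤ δ) (hμ0 : 0 ≤ μ)
    (hμ : μ ≤ ∑ w ∈ W, bernProb p (Z w)) :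
    bernProb p {ω | (countEvents W Z ω : ℝ) < (1 - δ) * μ} ≤ exp (-(δ ^ 2 * μ / 2)) := by
  have h2 : bernProb p {ω | (countEvents W Z ω : ℝ) < (1 - δ) * μ}
      ≤ bernExp p (fun ω => exp (δ * ((1 - δ) * μ)) * exp (-δ * countEvents W Z ω)) := by
    refine bernProb_le_of_exp h0 h1 (fun ω => by positivity) fun ω hω => ?_
    rw [← Real.exp_add]
    refine Real.one_le_exp ?_
    have : (countEvents W Z ω : ℝ) < (1 - δ) * μ := hω
    nlinarith
  refine h2.trans ?_
  rw [bernExp_const_mul]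
  refine (mul_le_mul_of_nonneg_left (bernExp_exp_countEvents_le h0 h1 W Z S hZ hS (-δ))
    (Real.exp_nonneg _)).trans ?_
  rw [← Real.exp_add]
  refine Real.exp_le_exp.mpr ?_
  have h3 := exp_neg_le_quadratic hδ
  have h4 : exp (-δ) ≤ 1 := Real.exp_le_one_iff.mpr (by linarith)
  have h5 := mul_le_mul_of_nonneg_right hμ (by linarith : 0 ≤ 1 - exp (-δ))
  have h6 := mul_le_mul_of_nonneg_left h3 hμ0
  nlinarith

/-- Chernoff bound, upper tail. -/
theorem bernProb_countEvents_upper {ι : Type*} {p : ℝ} (h0 : 0 ≤ p) (h1 : p ≤ 1)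
    (W : Finset ι) (Z : ι → Set (E → Bool)) (S : ι → Set E)
    (hZ : ∀ w ∈ W, DependsOn (fun ω => ω ∈ Z w) (S w))
    (hS : (W : Set ι).PairwiseDisjoint S) {μ δ : ℝ} (hδ : 0 ≤ δ) (hδ2 : δ ≤ 2) (hμ0 : 0 ≤ μ)
    (hμ : ∑ w ∈ W, bernProb p (Z w) ≤ μ) :
    bernProb p {ω | (1 + δ) * μ < (countEvents W Z ω : ℝ)} ≤ exp (-(δ ^ 2 * μ / 4)) := by
  have h2 : bernProb p {ω | (1 + δ) * μ < (countEvents W Z ω : ℝ)}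
      ≤ bernExp p (fun ω =>
        exp (-(δ / 2 * ((1 + δ) * μ))) * exp (δ / 2 * countEvents W Z ω)) := by
    refine bernProb_le_of_exp h0 h1 (fun ω => by positivity) fun ω hω => ?_
    rw [← Real.exp_add]
    refine Real.one_le_exp ?_
    have : (1 + δ) * μ < (countEvents W Z ω : ℝ) := hω
    nlinarith
  refine h2.trans ?_
  rw [bernExp_const_mul]
  refine (mul_le_mul_of_nonneg_left (bernExp_exp_countEvents_le h0 h1 W Z S hZ hS (δ / 2))
    (Real.exp_nonneg _)).trans ?_
  rw [← Real.exp_add]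
  refine Real.exp_le_exp.mpr ?_
  have h3 := (abs_le.mp (Real.abs_exp_sub_one_sub_id_le (x := δ / 2)
    (by rw [abs_of_nonneg] <;> linarith))).2
  have h4 : 1 ≤ exp (δ / 2) := Real.one_le_exp (by linarith)
  have h5 := mul_le_mul_of_nonneg_right hμ (by linarith : 0 ≤ exp (δ / 2) - 1)
  have h6 := mul_le_mul_of_nonneg_left h3 hμ0
  nlinarith

theorem bernProb_countEvents_markov {ι : Type*} {p K b : ℝ}
    (h0 : 0 ≤ p) (h1 : p ≤ 1) (hK : 0 < K) (W : Finset ι) (Z : ι → Set (E → Bool))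
    (hb : ∀ w ∈ W, bernProb p (Z w) ≤ b) :
    bernProb p {ω | K < (countEvents W Z ω : ℝ)} ≤ W.card * b / K := by
  classical
  have hc : ∀ ω, (countEvents W Z ω : ℝ) = ∑ w ∈ W, (Z w).indicator 1 ω := by
    intro ω
    simp [countEvents, Set.indicator_apply]
  calc _ ≤ bernExp p (fun ω => K⁻¹ * ∑ w ∈ W, (Z w).indicator 1 ω) := by
        refine bernProb_le_of_exp h0 h1 (fun ω => ?_) fun ω hω => ?_
        · rw [← hc]
          positivity
        · have : K < (countEvents W Z ω : ℝ) := hω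
          rw [← hc, inv_mul_eq_div, one_le_div hK]
          exact this.le
    _ = K⁻¹ * ∑ w ∈ W, bernProb p (Z w) := by rw [bernExp_const_mul, bernExp_sum]; rfl
    _ ≤ K⁻¹ * (W.card * b) := by
        refine mul_le_mul_of_nonneg_left ?_ (by positivity)
        simpa using Finset.sum_le_card_nsmul W _ b hb
    _ = _ := by ring

end BernoulliProduct

section RandomGraph

variable {V : Type*}

/-- The non-diagonal unordered pairs of elements of `V`. -/
abbrev EdgeIdx (V : Type*) : Type _ := {e : Sym2 V // ¬ e.IsDiag}

/-- The graph whose edges are the pairs marked `true`. -/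
def graphOf (ω : EdgeIdx V → Bool) : SimpleGraph V where
  Adj x y := ∃ h : ¬ (s(x, y)).IsDiag, ω ⟨s(x, y), h⟩ = true
  symm := ⟨by
    rintro x y ⟨h, hω⟩
    exact ⟨by rwa [Sym2.eq_swap], by simpa only [Sym2.eq_swap] using hω⟩⟩
  loopless := ⟨fun x ⟨h, _⟩ => h rfl⟩

theorem graphOf_adj {ω : EdgeIdx V → Bool} {x y : V} (h : ¬ (s(x, y)).IsDiag) :
    (graphOf ω).Adj x y ↔ ω ⟨s(x, y), h⟩ = true :=
  ⟨fun ⟨_, h⟩ => h, fun h' => ⟨h, h'⟩⟩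

theorem mem_edgeSet_graphOf (ω : EdgeIdx V → Bool) (e : EdgeIdx V) :
    e.1 ∈ (graphOf ω).edgeSet ↔ ω e = true := by
  obtain ⟨e, he⟩ := e
  induction e using Sym2.ind with
  | _ x y => exact graphOf_adj he

open scoped Classical in
/-- Graphs on `V` correspond to Boolean functions on the non-diagonal pairs. -/
noncomputable def graphEquiv (V : Type*) : (EdgeIdx V → Bool) ≃ SimpleGraph V where
  toFun := graphOf
  invFun G e := decide (e.1 ∈ G.edgeSet)
  left_inv ω := by
    ext e
    simp [mem_edgeSet_graphOf]
  right_inv G := by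
    ext x y
    constructor
    · rintro ⟨h, hω⟩
      simpa using hω
    · intro h
      exact ⟨by simpa using h.ne, by simpa using h⟩

theorem gnpWeight_graphOf {n : ℕ} (p : ℝ) (ω : EdgeIdx (Fin n) → Bool) :
    gnpWeight n p (graphOf ω) = bernWeight p ω := by
  have hc : Nat.card (graphOf ω).edgeSet = (Finset.univ.filter fun e => ω e = true).card := by
    rw [← Fintype.card_subtype, ← Nat.card_eq_fintype_card]
    refine Nat.card_congr ⟨fun e => ⟨⟨e.1, SimpleGraph.not_isDiag_of_mem_edgeSet _ e.2⟩,
      (mem_edgeSet_graphOf ω _).mp e.2⟩, fun e => ⟨e.1.1, (mem_edgeSet_graphOf ω e.1).mpr e.2⟩,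
      fun _ => rfl, fun _ => rfl⟩
  have ht : n.choose 2 = Fintype.card (EdgeIdx (Fin n)) := by
    rw [Sym2.card_subtype_not_diag, Fintype.card_fin]
  rw [gnpWeight, bernWeight, Finset.prod_ite, Finset.prod_const, Finset.prod_const, hc, ht,
    ← Finset.card_univ, ← Finset.card_filter_add_card_filter_not (s := Finset.univ)
      (fun e => ω e = true), Nat.add_sub_cancel_left]

theorem gnpProb_eq_bernProb (n : ℕ) (p : ℝ) (A : Set (SimpleGraph (Fin n))) :
    gnpProb n p A = bernProb p {ω : EdgeIdx (Fin n) → Bool | graphOf ω ∈ A} := by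
  classical
  rw [gnpProb, tsum_fintype, ← Equiv.sum_comp (graphEquiv (Fin n)), bernProb, bernExp]
  refine Finset.sum_congr rfl fun ω _ => ?_
  change A.indicator (gnpWeight n p) (graphOf ω) = _
  by_cases h : graphOf ω ∈ A <;> simp [h, gnpWeight_graphOf]

variable [Fintype V] [DecidableEq V]

open scoped Classical in
/-- The vertices joined to `R` by a walk of length at most `k`. -/
noncomputable def reach (R : Finset V) (G : SimpleGraph V) : ℕ → Finset V
  | 0 => R
  | k + 1 => reach R G k ∪ Finset.univ.filter fun w => ∃ u ∈ reach R G k, G.Adj u w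

/-- The previous ball `reach R G (k - 1)`, empty for `k = 0`. -/
noncomputable def reachPred (R : Finset V) (G : SimpleGraph V) : ℕ → Finset V
  | 0 => ∅
  | k + 1 => reach R G k

theorem mem_reach_succ {R : Finset V} {G : SimpleGraph V} {k : ℕ} {w : V} :
    w ∈ reach R G (k + 1) ↔ w ∈ reach R G k ∨ ∃ u ∈ reach R G k, G.Adj u w := by
  simp [reach]

theorem reachPred_subset (R : Finset V) (G : SimpleGraph V) (k : ℕ) :
    reachPred R G k ⊆ reach R G k := by
  cases k with
  | zero => simp [reachPred]
  | succ k => exact Finset.subset_union_left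

theorem mem_reach_iff {R : Finset V} {G : SimpleGraph V} {k : ℕ} {w : V} :
    w ∈ reach R G k ↔ ∃ u ∈ R, G.Reachable u w ∧ G.dist u w ≤ k := by
  induction k generalizing w with
  | zero =>
    constructor
    · intro h
      exact ⟨w, h, SimpleGraph.Reachable.refl w, by simp⟩
    · rintro ⟨u, hu, hr, hd⟩
      have : u = w := (hr.dist_eq_zero_iff).mp (by omega)
      exact this ▸ hu
  | succ k ih =>
    rw [mem_reach_succ, ih]
    constructor
    · rintro (⟨u, hu, hr, hd⟩ | ⟨v, hv, hvw⟩)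
      · exact ⟨u, hu, hr, by omega⟩
      · obtain ⟨u, hu, hr, hd⟩ := ih.mp hv
        obtain ⟨q, hq⟩ := hr.exists_walk_length_eq_dist
        refine ⟨u, hu, hr.trans hvw.reachable, (SimpleGraph.dist_le (q.concat hvw)).trans ?_⟩
        rw [SimpleGraph.Walk.length_concat]
        omega
    · rintro ⟨u, hu, hr, hd⟩
      rcases Nat.lt_or_ge (G.dist u w) (k + 1) with h | h
      · exact Or.inl ⟨u, hu, hr, by omega⟩
      · right
        obtain ⟨q, hq⟩ := hr.symm.exists_walk_length_eq_dist
        rw [SimpleGraph.dist_comm] at hq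
        cases q with
        | nil => simp at h
        | cons hadj q' =>
          rename_i v
          rw [SimpleGraph.Walk.length_cons] at hq
          refine ⟨v, ih.mpr ⟨u, hu, q'.reachable.symm, ?_⟩, hadj.symm⟩
          rw [SimpleGraph.dist_comm]
          exact (SimpleGraph.dist_le q').trans (by omega)

/-- A vertex not reached within `k` steps can only be reached at step `k + 1` through a vertex at
distance exactly `k`. -/
theorem mem_reach_succ_of_notMem {R : Finset V} {G : SimpleGraph V} {k : ℕ} {w : V}
    (hw : w ∉ reach R G k) :
    w ∈ reach R G (k + 1) ↔ ∃ u ∈ reach R G k \ reachPred R G k, G.Adj u w := by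
  rw [mem_reach_succ]
  constructor
  · rintro (h | ⟨u, hu, hadj⟩)
    · exact absurd h hw
    · refine ⟨u, Finset.mem_sdiff.mpr ⟨hu, fun hI => hw ?_⟩, hadj⟩
      cases k with
      | zero => simp [reachPred] at hI
      | succ k => exact mem_reach_succ.mpr (Or.inr ⟨u, hI, hadj⟩)
  · rintro ⟨u, hu, hadj⟩
    exact Or.inr ⟨u, (Finset.mem_sdiff.mp hu).1, hadj⟩

theorem card_reach_le {R : Finset V} {G : SimpleGraph V} {Δ : ℝ} (hΔ0 : 0 ≤ Δ)
    (hΔ : ∀ x, ((reach {x} G 1 \ {x}).card : ℝ) ≤ Δ) (k : ℕ) :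
    ((reach R G k).card : ℝ) ≤ R.card * (1 + Δ) ^ k := by
  induction k with
  | zero => simp [reach]
  | succ k ih =>
    have hsub : reach R G (k + 1) ⊆ reach R G k ∪ (reach R G k).biUnion
        fun x => reach {x} G 1 \ {x} := by
      intro w hw
      rcases mem_reach_succ.mp hw with h | ⟨u, hu, hadj⟩
      · exact Finset.mem_union_left _ h
      · refine Finset.mem_union_right _ (Finset.mem_biUnion.mpr ⟨u, hu, ?_⟩)
        rw [Finset.mem_sdiff, Finset.mem_singleton, mem_reach_succ]
        exact ⟨Or.inr ⟨u, by simp [reach], hadj⟩, hadj.ne'⟩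
    have h2 : (((reach R G k).biUnion fun x => reach {x} G 1 \ {x}).card : ℝ)
        ≤ (reach R G k).card * Δ := by
      calc _ ≤ ∑ x ∈ reach R G k, ((reach {x} G 1 \ {x}).card : ℝ) := by
            exact_mod_cast Finset.card_biUnion_le
        _ ≤ ∑ x ∈ reach R G k, Δ := Finset.sum_le_sum fun x _ => hΔ x
        _ = _ := by simp
    have h3 : ((reach R G (k + 1)).card : ℝ) ≤ (reach R G k).card + (reach R G k).card * Δ := by
      refine le_trans ?_ (add_le_add_right h2 _)
      exact_mod_cast (Finset.card_le_card hsub).trans (Finset.card_union_le _ _)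
    rw [pow_succ]
    nlinarith

theorem reach_congr (R : Finset V) (k : ℕ) {ω ω' : EdgeIdx V → Bool}
    (h : ∀ e : EdgeIdx V, (∃ u ∈ reachPred R (graphOf ω) k, u ∈ e.1) → ω e = ω' e) :
    reach R (graphOf ω') k = reach R (graphOf ω) k ∧
      reachPred R (graphOf ω') k = reachPred R (graphOf ω) k := by
  induction k with
  | zero => exact ⟨rfl, rfl⟩
  | succ k ih =>
    have h1 := (ih fun e ⟨u, hu, hue⟩ => h e ⟨u, reachPred_subset _ _ _ hu, hue⟩).1
    refine ⟨?_, h1⟩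
    ext w
    rw [mem_reach_succ, mem_reach_succ, h1]
    refine or_congr Iff.rfl (exists_congr fun u => and_congr_right fun hu => ?_)
    refine exists_congr fun hd => ?_
    rw [h ⟨s(u, w), hd⟩ ⟨u, hu, by simp⟩]

/-- The pairs with one element in `A \ I` and the other outside `A`. -/
def frontierPairs (I A : Finset V) : Set (EdgeIdx V) :=
  {e | ∃ t ∈ A \ I, ∃ w ∉ A, e.1 = s(t, w)}

/-- Conditioning on the exploration up to radius `k` leaves the pairs between the last sphere and
the unexplored vertices independent. -/
theorem bernProb_exposure_le {p b : ℝ} (h0 : 0 ≤ p) (h1 : p ≤ 1) (hb : 0 ≤ b)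
    (R : Finset V) (k : ℕ)
    (good : Finset V → Finset V → Prop) (F : Finset V → Finset V → Set (EdgeIdx V → Bool))
    (hF : ∀ I A, DependsOn (fun ω => ω ∈ F I A) (frontierPairs I A))
    (hFb : ∀ I A, I ⊆ A → good I A → bernProb p (F I A) ≤ b) :
    bernProb p {ω | good (reachPred R (graphOf ω) k) (reach R (graphOf ω) k) ∧
      ω ∈ F (reachPred R (graphOf ω) k) (reach R (graphOf ω) k)} ≤ b := by
  classical
  let X : Finset V × Finset V → Set (EdgeIdx V → Bool) := fun x =>
    {ω | reachPred R (graphOf ω) k = x.1 ∧ reach R (graphOf ω) k = x.2}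
  have hX : ∀ x, DependsOn (fun ω => ω ∈ X x) {e : EdgeIdx V | ∃ u ∈ x.1, u ∈ e.1} := by
    have aux : ∀ x ω ω', (∀ e ∈ {e : EdgeIdx V | ∃ u ∈ x.1, u ∈ e.1}, ω e = ω' e) →
        ω ∈ X x → ω' ∈ X x := by
      rintro x ω ω' h ⟨hI, hA⟩
      have := reach_congr R k (ω := ω) (ω' := ω') (by rw [hI]; exact h)
      exact ⟨this.2.trans hI, this.1.trans hA⟩
    intro x ω ω' h
    exact propext ⟨aux x ω ω' h, aux x ω' ω fun e he => (h e he).symm⟩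
  let gd : Finset (Finset V × Finset V) := Finset.univ.filter fun x => good x.1 x.2 ∧ x.1 ⊆ x.2
  have hind : ∀ (A : Set (EdgeIdx V → Bool)) (S : Set (EdgeIdx V)),
      DependsOn (fun ω => ω ∈ A) S →
      DependsOn (A.indicator (1 : (EdgeIdx V → Bool) → ℝ)) S := by
    intro A S h x y hxy
    have := h hxy
    simp only [eq_iff_iff] at this
    simp only [Set.indicator_apply, this, Pi.one_apply]
  have hprod : ∀ x ∈ gd, bernExp p (fun ω => (X x).indicator 1 ω * (F x.1 x.2).indicator 1 ω)
      ≤ b * bernProb p (X x) := by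
    intro x hx
    obtain ⟨hg, hs⟩ := (Finset.mem_filter.mp hx).2
    rw [bernExp_mul_of_dependsOn p (hind _ _ (hX x)) (hind _ _ (hF x.1 x.2)), mul_comm b]
    · exact mul_le_mul_of_nonneg_left (hFb _ _ hs hg) (bernProb_nonneg h0 h1 _)
    · rw [Set.disjoint_left]
      rintro e ⟨u, hu, hue⟩ ⟨t, ht, w, hw, he⟩
      rw [he, Sym2.mem_iff] at hue
      rcases hue with rfl | rfl
      · exact (Finset.mem_sdiff.mp ht).2 hu
      · exact hw (hs hu)
  calc _ ≤ bernExp p (fun ω => ∑ x ∈ gd, (X x).indicator 1 ω * (F x.1 x.2).indicator 1 ω) := by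
        have hnn : ∀ ω x, (0 : ℝ) ≤ (X x).indicator 1 ω * (F x.1 x.2).indicator 1 ω := fun ω x =>
          mul_nonneg (Set.indicator_nonneg (fun _ _ => zero_le_one) ω)
            (Set.indicator_nonneg (fun _ _ => zero_le_one) ω)
        refine bernProb_le_of_exp h0 h1 (fun ω => Finset.sum_nonneg fun x _ => hnn ω x) ?_
        rintro ω ⟨hg, hω⟩
        refine le_trans ?_ (Finset.single_le_sum (fun x _ => hnn ω x)
          (a := (reachPred R (graphOf ω) k, reach R (graphOf ω) k))
          (Finset.mem_filter.mpr ⟨Finset.mem_univ _, hg, reachPred_subset _ _ _⟩))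
        simp [X, hω]
    _ ≤ ∑ x ∈ gd, b * bernProb p (X x) := by
        rw [bernExp_sum]
        exact Finset.sum_le_sum hprod
    _ ≤ b * 1 := by
        rw [← Finset.mul_sum]
        refine mul_le_mul_of_nonneg_left ?_ hb
        simp only [bernProb]
        rw [← bernExp_sum, ← bernExp_const (E := EdgeIdx V) p 1]
        refine bernExp_mono h0 h1 fun ω => ?_
        have : ∀ x ∈ gd, (X x).indicator (1 : (EdgeIdx V → Bool) → ℝ) ω
            = if x = (reachPred R (graphOf ω) k, reach R (graphOf ω) k) then 1 else 0 := by
          intro x _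
          simp only [Set.indicator_apply, X, Set.mem_ofPred_eq, Prod.ext_iff, Pi.one_apply,
            eq_comm]
        rw [Finset.sum_congr rfl this, Finset.sum_ite_eq']
        split_ifs <;> simp
    _ = b := mul_one b

/-- The event that `w` has no neighbour in `T`. -/
def noHit (T : Finset V) (w : V) : Set (EdgeIdx V → Bool) :=
  {ω | ∀ t ∈ T, ¬ (graphOf ω).Adj t w}

omit [Fintype V] [DecidableEq V] in
theorem mem_noHit_congr {T : Finset V} {w : V} {ω ω' : EdgeIdx V → Bool}
    (h : ∀ e : EdgeIdx V, (∃ t ∈ T, e.1 = s(t, w)) → ω e = ω' e) :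
    ω ∈ noHit T w ↔ ω' ∈ noHit T w := by
  refine forall₂_congr fun t ht => not_congr (exists_congr fun hd => ?_)
  rw [h ⟨s(t, w), hd⟩ ⟨t, ht, rfl⟩]

theorem bernProb_noHit (p : ℝ) {T : Finset V} {w : V} (hw : w ∉ T) :
    bernProb p (noHit T w) = (1 - p) ^ T.card := by
  classical
  have hd : ∀ t ∈ T, ¬ (s(t, w)).IsDiag := by
    intro t ht h
    exact hw ((Sym2.mk_isDiag_iff.mp h) ▸ ht)
  let S : Finset (EdgeIdx V) := T.attach.image fun t => ⟨s(t.1, w), hd t.1 t.2⟩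
  have hS : S.card = T.card := by
    rw [Finset.card_image_of_injOn, Finset.card_attach]
    rintro ⟨t, ht⟩ _ ⟨t', ht'⟩ _ h
    have h' : s(t, w) = s(t', w) := congrArg Subtype.val h
    exact Subtype.ext (Sym2.congr_left.mp h')
  rw [← hS, ← bernProb_forall_false]
  congr 1
  ext ω
  constructor
  · intro h e he
    obtain ⟨⟨t, ht⟩, -, rfl⟩ := Finset.mem_image.mp he
    exact Bool.eq_false_iff.mpr fun hω => h t ht ⟨hd t ht, hω⟩
  · rintro h t ht ⟨_, hω⟩
    have := h ⟨s(t, w), hd t ht⟩ (Finset.mem_image.mpr ⟨⟨t, ht⟩, Finset.mem_attach _ _, rfl⟩)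
    simp_all

omit [Fintype V] [DecidableEq V] in
theorem pairwiseDisjoint_pairs {T W : Finset V} (hTW : Disjoint T W) :
    (W : Set V).PairwiseDisjoint fun w => {e : EdgeIdx V | ∃ t ∈ T, e.1 = s(t, w)} := by
  intro w hw w' hw' hne
  refine Set.disjoint_left.mpr ?_
  rintro e ⟨t, ht, he⟩ ⟨t', ht', he'⟩
  rw [he, Sym2.eq_iff] at he'
  rcases he' with ⟨-, h⟩ | ⟨h, -⟩
  · exact hne h
  · exact Finset.disjoint_left.mp hTW ht (h ▸ hw')

omit [Fintype V] [DecidableEq V] in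
theorem dependsOn_noHit (T : Finset V) (w : V) :
    DependsOn (fun ω : EdgeIdx V → Bool => ω ∈ noHit T w) {e | ∃ t ∈ T, e.1 = s(t, w)} :=
  fun _ _ h => propext (mem_noHit_congr fun e he => h e he)

omit [Fintype V] [DecidableEq V] in
theorem dependsOn_noHit_compl (T : Finset V) (w : V) :
    DependsOn (fun ω : EdgeIdx V → Bool => ω ∈ (noHit T w)ᶜ) {e | ∃ t ∈ T, e.1 = s(t, w)} :=
  fun _ _ h => propext (not_congr (mem_noHit_congr fun e he => h e he))

theorem countEvents_congr {ι Ω : Type*} {W : Finset ι} {Z : ι → Set Ω} {ω ω' : Ω}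
    (h : ∀ w ∈ W, (ω ∈ Z w ↔ ω' ∈ Z w)) : countEvents W Z ω = countEvents W Z ω' := by
  classical
  rw [countEvents, countEvents, Finset.filter_congr h]

theorem dependsOn_countEvents_noHit (I A : Finset V) (P : ℕ → Prop) :
    DependsOn (fun ω => ω ∈ {ω | P (countEvents Aᶜ (noHit (A \ I)) ω)}) (frontierPairs I A) := by
  intro ω ω' h
  refine congrArg P (countEvents_congr fun w hw => mem_noHit_congr ?_)
  rintro e ⟨t, ht, he⟩
  exact h e ⟨t, ht, w, Finset.mem_compl.mp hw, he⟩

theorem dependsOn_countEvents_noHit_compl (I A : Finset V) (P : ℕ → Prop) :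
    DependsOn (fun ω => ω ∈ {ω | P (countEvents Aᶜ (fun w => (noHit (A \ I) w)ᶜ) ω)})
      (frontierPairs I A) := by
  intro ω ω' h
  refine congrArg P (countEvents_congr fun w hw => not_congr (mem_noHit_congr ?_))
  rintro e ⟨t, ht, he⟩
  exact h e ⟨t, ht, w, Finset.mem_compl.mp hw, he⟩

theorem card_reach_succ_sdiff (R : Finset V) (ω : EdgeIdx V → Bool) (k : ℕ) :
    (reach R (graphOf ω) (k + 1) \ reach R (graphOf ω) k).card =
      countEvents (reach R (graphOf ω) k)ᶜ
        (fun w => (noHit (reach R (graphOf ω) k \ reachPred R (graphOf ω) k) w)ᶜ) ω := by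
  classical
  rw [countEvents]
  congr 1
  ext w
  simp only [Finset.mem_sdiff, Finset.mem_filter, Finset.mem_compl, noHit, Set.mem_compl_iff,
    Set.mem_ofPred_eq, not_forall, not_not]
  rw [and_comm]
  refine and_congr_right fun hw => ?_
  rw [mem_reach_succ_of_notMem hw]
  simp

theorem card_reach_succ_compl (R : Finset V) (ω : EdgeIdx V → Bool) (k : ℕ) :
    ((reach R (graphOf ω) (k + 1))ᶜ).card =
      countEvents (reach R (graphOf ω) k)ᶜ
        (noHit (reach R (graphOf ω) k \ reachPred R (graphOf ω) k)) ω := by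
  classical
  rw [countEvents]
  congr 1
  ext w
  rw [Finset.mem_filter, Finset.mem_compl, Finset.mem_compl]
  constructor
  · intro h
    have hw : w ∉ reach R (graphOf ω) k := fun h' => h (mem_reach_succ.mpr (Or.inl h'))
    refine ⟨hw, fun t ht hadj => h ((mem_reach_succ_of_notMem hw).mpr ⟨t, ht, hadj⟩)⟩
  · rintro ⟨hw, h⟩ h'
    obtain ⟨t, ht, hadj⟩ := (mem_reach_succ_of_notMem hw).mp h'
    exact h t ht hadj

theorem disjoint_sdiff_compl (I A : Finset V) : Disjoint (A \ I) Aᶜ :=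
  disjoint_compl_right.mono_left Finset.sdiff_subset

theorem bernProb_degree_le {p δ d : ℝ} (h0 : 0 ≤ p) (h1 : p ≤ 1) (hδ : 0 ≤ δ) (hδ2 : δ ≤ 2)
    (hd : ((Fintype.card V : ℝ) - 1) * p ≤ d) (hd0 : 0 ≤ d) (x : V) :
    bernProb p {ω | (1 + δ) * d < ((reach {x} (graphOf ω) 1 \ {x}).card : ℝ)}
      ≤ exp (-(δ ^ 2 * d / 4)) := by
  have h := bernProb_countEvents_upper h0 h1 ({x} : Finset V)ᶜ
    (fun w => (noHit ({x} \ ∅ : Finset V) w)ᶜ) _ (fun w _ => dependsOn_noHit_compl _ w)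
    (pairwiseDisjoint_pairs (disjoint_sdiff_compl ∅ {x})) hδ hδ2 hd0 ?_
  · have h2 : ∀ ω : EdgeIdx V → Bool, (reach {x} (graphOf ω) 1 \ {x}).card = _ :=
      fun ω => card_reach_succ_sdiff {x} ω 0
    simp only [h2]
    exact h
  · have : ∀ w ∈ ({x} : Finset V)ᶜ, bernProb p (noHit ({x} \ ∅ : Finset V) w)ᶜ = p := by
      intro w hw
      have h3 := bernProb_compl p (noHit ({x} \ ∅ : Finset V) w)
      rw [bernProb_noHit p (by simpa using hw)] at h3
      simp only [Finset.sdiff_empty, Finset.card_singleton, pow_one] at h3 ⊢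
      linarith
    rw [Finset.sum_congr rfl this, Finset.sum_const, Finset.card_compl, Finset.card_singleton,
      nsmul_eq_mul, Nat.cast_sub (Fintype.card_pos_iff.mpr ⟨x⟩)]
    exact_mod_cast hd

theorem pow_le_exp_neg {p L : ℝ} (h0 : 0 ≤ p) (h1 : p ≤ 1) {s : ℕ} (hs : L ≤ s) :
    (1 - p) ^ s ≤ exp (-(p * L)) := by
  calc (1 - p) ^ s ≤ exp (-p) ^ s :=
        pow_le_pow_left₀ (by linarith) (by linarith [Real.add_one_le_exp (-p)]) s
    _ = exp (-(p * s)) := by rw [← Real.exp_nat_mul]; ring_nf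
    _ ≤ _ := Real.exp_le_exp.mpr (by nlinarith)

theorem bernProb_sphere_le {p δ μ L N : ℝ} (h0 : 0 ≤ p) (h1 : p ≤ 1) (hδ : 0 ≤ δ) (hμ0 : 0 ≤ μ)
    (hL : 0 ≤ L) (hμ : μ ≤ ((Fintype.card V : ℝ) - N) * (1 - exp (-(p * L))))
    (R : Finset V) (k : ℕ) :
    bernProb p {ω | (((reach R (graphOf ω) k).card : ℝ) ≤ N ∧
        L ≤ ((reach R (graphOf ω) k \ reachPred R (graphOf ω) k).card : ℝ)) ∧
        ((reach R (graphOf ω) (k + 1) \ reach R (graphOf ω) k).card : ℝ) < (1 - δ) * μ}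
      ≤ exp (-(δ ^ 2 * μ / 2)) := by
  have h := bernProb_exposure_le h0 h1 (Real.exp_nonneg (-(δ ^ 2 * μ / 2))) R k
    (fun I A => (A.card : ℝ) ≤ N ∧ L ≤ ((A \ I).card : ℝ))
    (fun I A => {ω | (countEvents Aᶜ (fun w => (noHit (A \ I) w)ᶜ) ω : ℝ) < (1 - δ) * μ})
    (fun I A => dependsOn_countEvents_noHit_compl I A fun m => (m : ℝ) < (1 - δ) * μ) ?_
  · simp only [card_reach_succ_sdiff]
    exact h
  · rintro I A - ⟨hA, hI⟩
    refine bernProb_countEvents_lower h0 h1 Aᶜ _ _ (fun w _ => dependsOn_noHit_compl _ w)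
      (pairwiseDisjoint_pairs (disjoint_sdiff_compl I A)) hδ hμ0 (hμ.trans ?_)
    have : ∀ w ∈ Aᶜ, bernProb p (noHit (A \ I) w)ᶜ = 1 - (1 - p) ^ (A \ I).card := by
      intro w hw
      have h3 := bernProb_compl p (noHit (A \ I) w)
      rw [bernProb_noHit p fun h => Finset.mem_compl.mp hw (Finset.mem_sdiff.mp h).1] at h3
      linarith
    rw [Finset.sum_congr rfl this, Finset.sum_const, Finset.card_compl, nsmul_eq_mul,
      Nat.cast_sub (Finset.card_le_univ A)]
    have h4 := pow_le_exp_neg h0 h1 hI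
    have h5 : exp (-(p * L)) ≤ 1 := Real.exp_le_one_iff.mpr (by nlinarith)
    have h6 : (A.card : ℝ) ≤ Fintype.card V := by exact_mod_cast Finset.card_le_univ A
    exact mul_le_mul (by linarith) (by linarith) (by linarith) (by linarith)

theorem bernProb_not_reach_le {p L : ℝ} (h0 : 0 ≤ p) (h1 : p ≤ 1) (R : Finset V) (k : ℕ) (y : V) :
    bernProb p {ω | L ≤ ((reach R (graphOf ω) k \ reachPred R (graphOf ω) k).card : ℝ) ∧
        y ∉ reach R (graphOf ω) (k + 1)} ≤ exp (-(p * L)) := by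
  have h := bernProb_exposure_le h0 h1 (Real.exp_nonneg (-(p * L))) R k
    (fun I A => L ≤ ((A \ I).card : ℝ) ∧ y ∉ A) (fun I A => {ω | y ∉ A ∧ ω ∈ noHit (A \ I) y})
    (fun I A ω ω' h => propext (and_congr_right fun hy => mem_noHit_congr fun e ⟨t, ht, he⟩ =>
      h e ⟨t, ht, y, hy, he⟩)) ?_
  · refine (bernProb_mono h0 h1 ?_).trans h
    rintro ω ⟨hL, hy⟩
    have hyk : y ∉ reach R (graphOf ω) k := fun h' => hy (mem_reach_succ.mpr (Or.inl h'))
    exact ⟨⟨hL, hyk⟩, hyk, fun t ht hadj => hy ((mem_reach_succ_of_notMem hyk).mpr ⟨t, ht, hadj⟩)⟩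
  · rintro I A - ⟨hL, hy⟩
    refine (bernProb_mono h0 h1 fun ω hω => hω.2).trans ?_
    rw [bernProb_noHit p fun h => hy (Finset.mem_sdiff.mp h).1]
    exact pow_le_exp_neg h0 h1 hL

theorem bernProb_uncovered_le {p μ κ a : ℝ} (h0 : 0 ≤ p) (h1 : p ≤ 1) (hκ : 0 ≤ κ)
    (hκp : exp (-κ) ≤ 1 - p) (hμ0 : 0 ≤ μ)
    (hμ : μ ≤ ((Fintype.card V : ℝ) - a) * exp (-(κ * a))) (R : Finset V) (k : ℕ) :
    bernProb p {ω | ((reach R (graphOf ω) k).card : ℝ) ≤ a ∧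
        (((reach R (graphOf ω) (k + 1))ᶜ.card : ℕ) : ℝ) < μ / 2} ≤ exp (-(μ / 8)) := by
  have h := bernProb_exposure_le h0 h1 (Real.exp_nonneg (-(μ / 8))) R k
    (fun I A => (A.card : ℝ) ≤ a)
    (fun I A => {ω | (countEvents Aᶜ (noHit (A \ I)) ω : ℝ) < μ / 2})
    (fun I A => dependsOn_countEvents_noHit I A fun m => (m : ℝ) < μ / 2) ?_
  · simp only [card_reach_succ_compl]
    exact h
  · rintro I A - hA
    have h2 := bernProb_countEvents_lower h0 h1 Aᶜ _ _ (fun w _ => dependsOn_noHit (A \ I) w)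
      (pairwiseDisjoint_pairs (disjoint_sdiff_compl I A)) (δ := 1 / 2) (by norm_num) hμ0
      (hμ.trans ?_)
    · convert h2 using 3 <;> ring_nf
    · have : ∀ w ∈ Aᶜ, bernProb p (noHit (A \ I) w) = (1 - p) ^ (A \ I).card := by
        intro w hw
        exact bernProb_noHit p fun h => Finset.mem_compl.mp hw (Finset.mem_sdiff.mp h).1
      rw [Finset.sum_congr rfl this, Finset.sum_const, Finset.card_compl, nsmul_eq_mul,
        Nat.cast_sub (Finset.card_le_univ A)]
      have h5 : exp (-(κ * a)) ≤ (1 - p) ^ (A \ I).card := by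
        calc exp (-(κ * a)) ≤ exp (-κ) ^ (A \ I).card := by
              rw [← Real.exp_nat_mul, Real.exp_le_exp]
              have : ((A \ I).card : ℝ) ≤ A.card := by
                exact_mod_cast Finset.card_le_card Finset.sdiff_subset
              nlinarith
          _ ≤ _ := pow_le_pow_left₀ (Real.exp_nonneg _) hκp _
      have h6 : (A.card : ℝ) ≤ Fintype.card V := by exact_mod_cast Finset.card_le_univ A
      exact mul_le_mul (by linarith) h5 (Real.exp_nonneg _) (by linarith)

/-- Two distinct vertices lie at distance exactly `m` from every vertex of `R`, and `R` does not
resolve `G`. -/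
def HasTwins (G : SimpleGraph V) (R : Finset V) (m : ℕ) : Prop :=
  (∃ u v : V, u ≠ v ∧ (∀ w ∈ R, G.Reachable w u ∧ G.dist w u = m) ∧
    (∀ w ∈ R, G.Reachable w v ∧ G.dist w v = m)) ∧ ¬ Resolves G ↑R

theorem hasTwins_of_card {G : SimpleGraph V} {R : Finset V} {k K : ℕ} {B : Finset (V × V)}
    (hB : ∀ x y, y ∉ reach {x} G (k + 1) → (x, y) ∈ B) (hBK : B.card ≤ K)
    (hR : K + 2 ≤ ((reach R G k)ᶜ).card) : HasTwins G R (k + 1) := by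
  classical
  have hcard : 1 < ((reach R G k)ᶜ \ B.image Prod.snd).card := by
    have h1 := Finset.le_card_sdiff (B.image Prod.snd) (reach R G k)ᶜ
    have h2 : (B.image Prod.snd).card ≤ B.card := Finset.card_image_le
    omega
  have hdist : ∀ u ∈ (reach R G k)ᶜ \ B.image Prod.snd, ∀ w ∈ R,
      G.Reachable w u ∧ G.dist w u = k + 1 := by
    intro u hu w hw
    obtain ⟨hu1, hu2⟩ := Finset.mem_sdiff.mp hu
    have h3 : u ∈ reach {w} G (k + 1) := by
      by_contra h
      exact hu2 (Finset.mem_image.mpr ⟨(w, u), hB w u h, rfl⟩)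
    obtain ⟨w', hw', hr, hd⟩ := mem_reach_iff.mp h3
    rw [Finset.mem_singleton] at hw'
    subst hw'
    refine ⟨hr, le_antisymm hd ?_⟩
    by_contra h
    exact Finset.mem_compl.mp hu1 (mem_reach_iff.mpr ⟨w', hw, hr, by omega⟩)
  obtain ⟨u, hu, v, hv, huv⟩ := Finset.one_lt_card.mp hcard
  refine ⟨⟨u, v, huv, hdist u hu, hdist v hv⟩, fun hres => ?_⟩
  obtain ⟨w, hw, hne⟩ := hres huv
  exact hne (by rw [(hdist u hu w hw).2, (hdist v hv w hw).2])

theorem bernProb_hasTwins_ge {p δ d m κ a ν K : ℝ} {k r : ℕ} {L μ : ℕ → ℝ}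
    (h0 : 0 ≤ p) (h1 : p ≤ 1) (hδ : 0 ≤ δ) (hδ2 : δ ≤ 2) (hd0 : 0 ≤ d)
    (hd : ((Fintype.card V : ℝ) - 1) * p ≤ d)
    (hL : ∀ j, 0 ≤ L j) (hL0 : L 0 ≤ 1) (hm : 0 ≤ m)
    (hμ : ∀ j ≤ k, μ j ≤
      ((Fintype.card V : ℝ) - (1 + (1 + δ) * d) ^ j) * (1 - exp (-(p * L j))))
    (hμL : ∀ j ≤ k, L (j + 1) ≤ (1 - δ) * μ j) (hμm : ∀ j ≤ k, m ≤ μ j)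
    (hκ : 0 ≤ κ) (hκp : exp (-κ) ≤ 1 - p) (ha : r * (1 + (1 + δ) * d) ^ k ≤ a)
    (hν : ν ≤ ((Fintype.card V : ℝ) - a) * exp (-(κ * a))) (hK : 0 < K) (hKν : K + 2 ≤ ν / 2) :
    1 - (Fintype.card V * exp (-(δ ^ 2 * d / 4))
      + Fintype.card V * (k + 1) * exp (-(δ ^ 2 * m / 2))
      + (Fintype.card V : ℝ) ^ 2 * exp (-(p * L (k + 1))) / K
      + (Fintype.card V).choose r * exp (-(ν / 8)))
      ≤ bernProb p {ω : EdgeIdx V → Bool | ∀ R : Finset V, R.card = r →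
          HasTwins (graphOf ω) R (k + 1 + 1)} := by
  classical
  let B1 : Set (EdgeIdx V → Bool) := ⋃ x ∈ (Finset.univ : Finset V),
    {ω | (1 + δ) * d < ((reach {x} (graphOf ω) 1 \ {x}).card : ℝ)}
  let B2 : Set (EdgeIdx V → Bool) := ⋃ x ∈ (Finset.univ : Finset V) ×ˢ Finset.range (k + 1),
    {ω | (((reach {x.1} (graphOf ω) x.2).card : ℝ) ≤ (1 + (1 + δ) * d) ^ x.2 ∧
        L x.2 ≤ ((reach {x.1} (graphOf ω) x.2 \ reachPred {x.1} (graphOf ω) x.2).card : ℝ)) ∧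
        ((reach {x.1} (graphOf ω) (x.2 + 1) \ reach {x.1} (graphOf ω) x.2).card : ℝ)
          < (1 - δ) * μ x.2}
  let Z : V × V → Set (EdgeIdx V → Bool) := fun x =>
    {ω | L (k + 1) ≤ ((reach {x.1} (graphOf ω) (k + 1) \
      reachPred {x.1} (graphOf ω) (k + 1)).card : ℝ) ∧ x.2 ∉ reach {x.1} (graphOf ω) (k + 1 + 1)}
  let B3 : Set (EdgeIdx V → Bool) := {ω | K < (countEvents Finset.univ Z ω : ℝ)}
  let B4 : Set (EdgeIdx V → Bool) := ⋃ R ∈ (Finset.univ : Finset V).powersetCard r,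
    {ω | ((reach R (graphOf ω) k).card : ℝ) ≤ a ∧
        (((reach R (graphOf ω) (k + 1))ᶜ.card : ℕ) : ℝ) < ν / 2}
  have hB1 : bernProb p B1 ≤ Fintype.card V * exp (-(δ ^ 2 * d / 4)) :=
    bernProb_biUnion_le h0 h1 _ _ fun x _ => bernProb_degree_le h0 h1 hδ hδ2 hd hd0 x
  have hB2 : bernProb p B2 ≤ Fintype.card V * (k + 1) * exp (-(δ ^ 2 * m / 2)) := by
    refine (bernProb_biUnion_le h0 h1 _ _ (b := exp (-(δ ^ 2 * m / 2))) fun x hx => ?_).trans ?_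
    · have hj : x.2 ≤ k := by
        have := Finset.mem_range.mp (Finset.mem_product.mp hx).2
        omega
      refine (bernProb_sphere_le h0 h1 hδ (hm.trans (hμm _ hj)) (hL _) (hμ _ hj) {x.1} x.2).trans ?_
      refine Real.exp_le_exp.mpr ?_
      have := mul_le_mul_of_nonneg_left (hμm _ hj) (sq_nonneg δ)
      linarith
    · simp [Finset.card_product]
  have hB3 : bernProb p B3 ≤ (Fintype.card V : ℝ) ^ 2 * exp (-(p * L (k + 1))) / K := by
    refine (bernProb_countEvents_markov h0 h1 hK _ _ fun x _ =>
      bernProb_not_reach_le h0 h1 {x.1} (k + 1) x.2).trans ?_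
    simp [Fintype.card_prod, sq]
  have hB4 : bernProb p B4 ≤ (Fintype.card V).choose r * exp (-(ν / 8)) := by
    refine (bernProb_biUnion_le h0 h1 _ _ fun R _ =>
      bernProb_uncovered_le h0 h1 hκ hκp (by linarith) hν R k).trans ?_
    simp [Finset.card_powersetCard]
  rw [bernProb_compl]
  suffices h : {ω : EdgeIdx V → Bool | ∀ R : Finset V, R.card = r →
      HasTwins (graphOf ω) R (k + 1 + 1)}ᶜ ⊆ B1 ∪ B2 ∪ B3 ∪ B4 by
    have e1 := bernProb_mono h0 h1 h
    have e2 := bernProb_union_le h0 h1 (B1 ∪ B2 ∪ B3) B4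
    have e3 := bernProb_union_le h0 h1 (B1 ∪ B2) B3
    have e4 := bernProb_union_le h0 h1 B1 B2
    linarith
  intro ω hω
  by_contra hbad
  simp only [Set.mem_union, not_or] at hbad
  obtain ⟨⟨⟨n1, n2⟩, n3⟩, n4⟩ := hbad
  simp only [B1, B2, B4, Set.mem_iUnion, not_exists, Set.mem_ofPred_eq, not_lt, Finset.mem_univ,
    Finset.mem_product, Finset.mem_range, Finset.mem_powersetCard, Finset.subset_univ, true_and,
    forall_const, not_and, Prod.forall, and_imp] at n1 n2 n4
  replace n3 : (countEvents Finset.univ Z ω : ℝ) ≤ K := not_lt.mp n3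
  have hΔ : 0 ≤ (1 + δ) * d := by positivity
  have hS : ∀ x j, j ≤ k + 1 →
      L j ≤ ((reach {x} (graphOf ω) j \ reachPred {x} (graphOf ω) j).card : ℝ) := by
    intro x j
    induction j with
    | zero =>
      intro _
      simpa [reach, reachPred] using hL0
    | succ j ih =>
      intro hj
      have hjk : j < k + 1 := by omega
      refine (hμL j (by omega)).trans (n2 x j hjk ?_ (ih (by omega)))
      simpa using card_reach_le (R := {x}) hΔ n1 j
  refine hω fun R hR => hasTwins_of_card
    (B := Finset.univ.filter fun x => ω ∈ Z x) (K := countEvents Finset.univ Z ω) ?_ ?_ ?_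
  · intro x y hy
    exact Finset.mem_filter.mpr ⟨Finset.mem_univ _, hS x (k + 1) le_rfl, hy⟩
  · rw [countEvents]
    exact le_of_eq (by congr)
  · have h5 := n4 R hR ((card_reach_le (R := R) hΔ n1 k).trans (by rw [hR]; exact ha))
    have : (countEvents Finset.univ Z ω : ℝ) + 2 ≤
        (((reach R (graphOf ω) (k + 1))ᶜ.card : ℕ) : ℝ) := by linarith
    exact_mod_cast this

end RandomGraph

section Numerics

/-- Size relations between the parameters that hold for all large `n`: here `N` is the number of
vertices, `ℓ = log N`, `s = √(ℓ / d)` and `ρ = d ^ (k + 1) / N`. -/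
structure ParamBounds (k : ℕ) (N p d ℓ s ρ ε η : ℝ) : Prop where
  hN : 2 ≤ N
  p_nonneg : 0 ≤ p
  d_eq : d = p * (N - 1)
  exp_log : exp ℓ = N
  ten_le : 10 ≤ ℓ
  d_ge : 4 * ℓ ≤ d
  s_nonneg : 0 ≤ s
  s_sq : s ^ 2 * d = ℓ
  rho_eq : ρ * N = d ^ (k + 1)
  eps_pos : 0 < ε
  eps_le : ε ≤ 1 / 2
  s_le : 96 * (k + 1) * 2 ^ (k + 2) * s ≤ ε
  rho_le : 96 * (k + 1) * 2 ^ (k + 2) * ρ ≤ 1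
  d_le : 64 * d ≤ ε * N
  loglog_le : 8 * Real.log ℓ ≤ ε * ℓ
  c_ge : 2 * ℓ ≤ d * ρ
  eta_eq : exp (η * ℓ) = d ^ (k + 1)

namespace ParamBounds

variable {k : ℕ} {N p d ℓ s ρ ε η : ℝ}

theorem d_pos (h : ParamBounds k N p d ℓ s ρ ε η) : 40 ≤ d := by
  linarith [h.ten_le, h.d_ge]

theorem rho_pos (h : ParamBounds k N p d ℓ s ρ ε η) : 0 < ρ := by
  have h1 := h.d_pos
  have h2 : 0 < d * ρ := by linarith [h.ten_le, h.c_ge]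
  exact pos_of_mul_pos_right h2 (by linarith)

theorem le_const (k : ℕ) : (1 : ℝ) ≤ (k + 1) * 2 ^ (k + 2) := by
  have h1 : (1 : ℝ) ≤ 2 ^ (k + 2) := one_le_pow₀ (by norm_num)
  have h2 : (0 : ℝ) ≤ k := Nat.cast_nonneg k
  nlinarith

theorem s_small (h : ParamBounds k N p d ℓ s ρ ε η) : 96 * s ≤ ε := by
  have := mul_le_mul_of_nonneg_right (le_const k) h.s_nonneg
  linarith [h.s_le]

theorem rho_small (h : ParamBounds k N p d ℓ s ρ ε η) : 96 * ρ ≤ 1 := by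
  have := mul_le_mul_of_nonneg_right (le_const k) h.rho_pos.le
  linarith [h.rho_le]

theorem mul_s_le (h : ParamBounds k N p d ℓ s ρ ε η) : 96 * ((k + 1) * s) ≤ ε := by
  have h1 : (1 : ℝ) ≤ 2 ^ (k + 2) := one_le_pow₀ (by norm_num)
  have h2 : 0 ≤ (k + 1) * s := mul_nonneg (by positivity) h.s_nonneg
  nlinarith [h.s_le]

theorem pow_mul_rho_le (h : ParamBounds k N p d ℓ s ρ ε η) : 96 * (2 ^ (k + 2) * ρ) ≤ 1 := by
  have h1 : 0 ≤ (2 : ℝ) ^ (k + 2) * ρ := mul_nonneg (by positivity) h.rho_pos.le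
  have h2 : (0 : ℝ) ≤ k := Nat.cast_nonneg k
  nlinarith [h.rho_le]

theorem gamma_mul_le (h : ParamBounds k N p d ℓ s ρ ε η) :
    (k + 1) * (3 * s + 2 ^ (k + 2) * ρ) ≤ 1 / 2 := by
  linarith [h.mul_s_le, h.rho_le, h.eps_le]

theorem gamma_nonneg (h : ParamBounds k N p d ℓ s ρ ε η) : 0 ≤ 3 * s + 2 ^ (k + 2) * ρ := by
  have h1 : 0 ≤ (2 : ℝ) ^ (k + 2) * ρ := mul_nonneg (by positivity) h.rho_pos.le
  linarith [h.s_nonneg]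

theorem gamma_le (h : ParamBounds k N p d ℓ s ρ ε η) : 3 * s + 2 ^ (k + 2) * ρ ≤ 1 / 2 := by
  linarith [h.s_small, h.pow_mul_rho_le, h.eps_le]

theorem p_mul_le (h : ParamBounds k N p d ℓ s ρ ε η) : p * N ≤ 2 * d := by
  have := h.d_eq
  nlinarith [mul_nonneg h.p_nonneg (by linarith [h.hN] : 0 ≤ N - 2)]

theorem p_small (h : ParamBounds k N p d ℓ s ρ ε η) : 32 * p ≤ ε := by
  have h1 := h.p_mul_le
  have h2 := h.d_le
  have h3 := h.hN
  by_contra hc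
  push Not at hc
  nlinarith

theorem sphere_growth (h : ParamBounds k N p d ℓ s ρ ε η) {j : ℕ} (hj : j ≤ k) :
    d / 2 ≤ (N - (1 + (1 + 3 * s) * d) ^ j) *
        (1 - exp (-(p * (d * (1 - (3 * s + 2 ^ (k + 2) * ρ))) ^ j))) ∧
      (d * (1 - (3 * s + 2 ^ (k + 2) * ρ))) ^ (j + 1) ≤
        (1 - 3 * s) * ((N - (1 + (1 + 3 * s) * d) ^ j) *
        (1 - exp (-(p * (d * (1 - (3 * s + 2 ^ (k + 2) * ρ))) ^ j)))) := by
  have hd := h.d_pos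
  have hγ := h.gamma_le
  have hγ0 := h.gamma_nonneg
  have hs0 := h.s_nonneg
  have hs := h.s_small
  have hε := h.eps_le
  have hρ := h.rho_small
  have hρ0 := h.rho_pos
  have hN := h.hN
  have hp := h.p_nonneg
  set γ := 3 * s + 2 ^ (k + 2) * ρ with hγdef
  set L := (d * (1 - γ)) ^ j with hL
  have hL1 : 1 ≤ L := one_le_pow₀ (by nlinarith)
  have hLd : L ≤ d ^ k :=
    (pow_le_pow_left₀ (by nlinarith) (by nlinarith) j).trans (pow_le_pow_right₀ (by linarith) hj)
  have hx : p * L ≤ 2 * ρ := by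
    have h1 : p * L * N ≤ 2 * ρ * N := by
      calc p * L * N = p * N * L := by ring
        _ ≤ (2 * d) * d ^ k := mul_le_mul h.p_mul_le hLd (by linarith) (by linarith)
        _ = 2 * (ρ * N) := by rw [h.rho_eq]; ring
        _ = _ := by ring
    exact le_of_mul_le_mul_right h1 (by linarith)
  have hx0 : 0 ≤ p * L := mul_nonneg hp (by linarith)
  have hexp : p * L * (1 - ρ) ≤ 1 - exp (-(p * L)) := by
    have := exp_neg_le_quadratic hx0
    nlinarith
  have hball : (1 + (1 + 3 * s) * d) ^ j ≤ 2 ^ k * ρ * N := by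
    calc (1 + (1 + 3 * s) * d) ^ j ≤ (2 * d) ^ j :=
          pow_le_pow_left₀ (by positivity) (by nlinarith) j
      _ ≤ (2 * d) ^ k := pow_le_pow_right₀ (by linarith) hj
      _ = 2 ^ k * d ^ k := mul_pow _ _ _
      _ ≤ 2 ^ k * d ^ (k + 1) := mul_le_mul_of_nonneg_left
          (pow_le_pow_right₀ (by linarith) (Nat.le_succ k)) (by positivity)
      _ = _ := by rw [← h.rho_eq]; ring
  have h2k : 2 ^ k * ρ + ρ ≤ 2 ^ (k + 2) * ρ := by
    have : (1 : ℝ) ≤ 2 ^ k := one_le_pow₀ (by norm_num)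
    rw [pow_add]
    nlinarith
  have hQ := h.pow_mul_rho_le
  have hk0 : 0 ≤ 2 ^ k * ρ := by positivity
  have hμ : d * L * (1 - 2 ^ (k + 2) * ρ) ≤
      (N - (1 + (1 + 3 * s) * d) ^ j) * (1 - exp (-(p * L))) := by
    have hpN : d ≤ p * N := by rw [h.d_eq]; nlinarith
    calc d * L * (1 - 2 ^ (k + 2) * ρ) ≤ d * L * ((1 - 2 ^ k * ρ) * (1 - ρ)) := by
          refine mul_le_mul_of_nonneg_left ?_ (by nlinarith)
          nlinarith [mul_nonneg hk0 hρ0.le]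
      _ ≤ p * N * L * ((1 - 2 ^ k * ρ) * (1 - ρ)) := by
          refine mul_le_mul_of_nonneg_right ?_ (mul_nonneg (by linarith) (by linarith))
          exact mul_le_mul_of_nonneg_right hpN (by linarith)
      _ = (N - 2 ^ k * ρ * N) * (p * L * (1 - ρ)) := by ring
      _ ≤ _ := by
          refine mul_le_mul (by linarith) hexp (mul_nonneg hx0 (by linarith)) ?_
          nlinarith
  have hdL : d ≤ d * L := by nlinarith
  constructor
  · nlinarith
  · calc (d * (1 - γ)) ^ (j + 1) = d * L * (1 - γ) := by rw [pow_succ, hL]; ring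
      _ ≤ d * L * ((1 - 3 * s) * (1 - 2 ^ (k + 2) * ρ)) := by
          refine mul_le_mul_of_nonneg_left ?_ (by linarith)
          rw [hγdef]
          nlinarith [mul_nonneg hs0 (by positivity : 0 ≤ 2 ^ (k + 2) * ρ)]
      _ = (1 - 3 * s) * (d * L * (1 - 2 ^ (k + 2) * ρ)) := by ring
      _ ≤ _ := mul_le_mul_of_nonneg_left hμ (by linarith)

theorem far_exponent (h : ParamBounds k N p d ℓ s ρ ε η) :
    2 * ℓ - ε * ℓ / 8 ≤ p * (d * (1 - (3 * s + 2 ^ (k + 2) * ρ))) ^ (k + 1) := by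
  have hd := h.d_pos
  have hγ := h.gamma_le
  have hγ0 := h.gamma_nonneg
  have hkγ := h.gamma_mul_le
  have hs0 := h.s_nonneg
  have hks := h.mul_s_le
  have hρ0 := h.rho_pos
  have hN := h.hN
  have hε := h.eps_pos
  have hℓ := h.ten_le
  set γ := 3 * s + 2 ^ (k + 2) * ρ with hγdef
  have hb : 1 - (k + 1) * γ ≤ (1 - γ) ^ (k + 1) := by
    have := one_add_mul_le_pow (by linarith : -2 ≤ -γ) (k + 1)
    push_cast at this
    rw [← sub_eq_add_neg] at this
    linarith
  have hc : d * ρ * (1 - (k + 1) * γ) ≤ p * (d * (1 - γ)) ^ (k + 1) := by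
    have hpN : d ≤ p * N := by rw [h.d_eq]; nlinarith [h.p_nonneg]
    calc d * ρ * (1 - (k + 1) * γ) ≤ d * ρ * (1 - γ) ^ (k + 1) :=
          mul_le_mul_of_nonneg_left hb (by positivity)
      _ ≤ p * N * ρ * (1 - γ) ^ (k + 1) := by
          have : 0 ≤ (1 - γ) ^ (k + 1) := pow_nonneg (by linarith) _
          gcongr
      _ = p * (ρ * N) * (1 - γ) ^ (k + 1) := by ring
      _ = _ := by rw [h.rho_eq, mul_pow]; ring
  refine le_trans ?_ hc
  have hc2 := h.c_ge
  rcases le_or_gt ((k + 1) * γ) (ε / 16) with hcase | hcase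
  · have : (1 - ε / 16) * (2 * ℓ) ≤ (1 - (k + 1) * γ) * (d * ρ) :=
      mul_le_mul (by linarith) hc2 (by linarith) (by linarith)
    linarith
  · have hs_pos : 0 < s := by
      refine lt_of_le_of_ne hs0 fun h0 => ?_
      have := h.s_sq
      rw [← h0] at this
      norm_num at this
      linarith
    have h1 : s ≤ ρ := by
      have h3 : (k + 1) * (2 ^ (k + 2) * s) ≤ (k + 1) * (2 ^ (k + 2) * ρ) := by
        linarith [h.s_le]
      exact le_of_mul_le_mul_left (le_of_mul_le_mul_left h3 (by positivity)) (by positivity)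
    have h4 : 4 * ℓ ≤ d * ρ := by
      have h5 : s * (4 * ℓ) ≤ s * (d * s) := by
        have h6 := h.s_sq
        have h7 := h.s_small
        have h8 := h.eps_le
        nlinarith
      have h9 := le_of_mul_le_mul_left h5 hs_pos
      nlinarith
    have : (1 / 2) * (4 * ℓ) ≤ (1 - (k + 1) * γ) * (d * ρ) :=
      mul_le_mul (by linarith) h4 (by linarith) (by linarith)
    nlinarith

theorem eta_le (h : ParamBounds k N p d ℓ s ρ ε η) : η ≤ 1 := by
  have h1 : exp (η * ℓ) ≤ exp (1 * ℓ) := by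
    rw [h.eta_eq, one_mul, h.exp_log, ← h.rho_eq]
    nlinarith [h.rho_small, h.hN]
  exact le_of_mul_le_mul_right (Real.exp_le_exp.mp h1) (by linarith [h.ten_le])

theorem eps_le_eta (h : ParamBounds k N p d ℓ s ρ ε η) : ε ≤ η := by
  have hd := h.d_pos
  have hℓ := h.ten_le
  have h1 : exp ℓ ≤ exp (2 * (η * ℓ)) := by
    rw [two_mul, Real.exp_add, h.eta_eq, h.exp_log]
    calc N ≤ d * ρ * N := by nlinarith [h.c_ge, h.hN]
      _ = d ^ 1 * d ^ (k + 1) := by rw [← h.rho_eq]; ring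
      _ ≤ _ := mul_le_mul_of_nonneg_right (pow_le_pow_right₀ (by linarith) (by omega))
          (by positivity)
  have h2 := Real.exp_le_exp.mp h1
  have h3 : (1 / 2 : ℝ) * ℓ ≤ η * ℓ := by linarith
  exact h.eps_le.trans (le_of_mul_le_mul_right h3 (by linarith))

theorem exp_neg_kappa_le (h : ParamBounds k N p d ℓ s ρ ε η) : exp (-(p + p ^ 2)) ≤ 1 - p := by
  have hp := h.p_nonneg
  have hp2 : p ≤ 1 / 4 := by linarith [h.p_small, h.eps_le]
  refine (exp_neg_le_quadratic (by positivity)).trans ?_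
  have h1 : (1 + p) ^ 2 ≤ 2 := by nlinarith
  nlinarith [mul_le_mul_of_nonneg_left h1 (sq_nonneg p)]

theorem loglog_eq (h : ParamBounds k N p d ℓ s ρ ε η) (m : ℕ) : ℓ ^ m = exp (m * Real.log ℓ) := by
  rw [Real.exp_nat_mul, Real.exp_log (by linarith [h.ten_le])]

theorem uncovered (h : ParamBounds k N p d ℓ s ρ ε η) {a : ℝ}
    (ha : a = (η - ε) * (N * ℓ / d ^ (k + 1)) * (1 + (1 + 3 * s) * d) ^ k) :
    exp (ε * ℓ / 2) / (2 * ρ) ≤ (N - a) * exp (-((p + p ^ 2) * a)) := by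
  have hd := h.d_pos
  have hs0 := h.s_nonneg
  have hρ0 := h.rho_pos
  have hN := h.hN
  have hε := h.eps_pos
  have hε2 := h.eps_le
  have hℓ := h.ten_le
  have hη := h.eta_le
  have hεη := h.eps_le_eta
  have hp := h.p_nonneg
  have hsd : 1 ≤ 3 * s * d := by
    by_contra hc
    push Not at hc
    have h1 := h.s_sq
    have h2 : (s * d) ^ 2 = ℓ * d := by rw [← h1]; ring
    have h3 : 0 ≤ s * d := by positivity
    nlinarith
  have hkε : 6 * (k * s) ≤ ε / 16 := by
    linarith [h.mul_s_le]
  have hdpos : 0 < d := by linarith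
  have ha_le : a ≤ (η - ε) * (N * ℓ / d) * exp (6 * (k * s)) := by
    have h1 : (1 + (1 + 3 * s) * d) ^ k ≤ d ^ k * exp (6 * (k * s)) := by
      calc (1 + (1 + 3 * s) * d) ^ k ≤ (d * exp (6 * s)) ^ k := by
            refine pow_le_pow_left₀ (by positivity) ?_ k
            nlinarith [Real.add_one_le_exp (6 * s)]
        _ = _ := by
            rw [mul_pow, ← Real.exp_nat_mul]
            ring_nf
    calc a ≤ (η - ε) * (N * ℓ / d ^ (k + 1)) * (d ^ k * exp (6 * (k * s))) := by
          rw [ha]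
          refine mul_le_mul_of_nonneg_left h1 (mul_nonneg (by linarith) (by positivity))
      _ = _ := by
          rw [pow_succ]
          field_simp
  have ha_half : a ≤ N / 2 := by
    have h1 : exp (6 * (k * s)) ≤ 2 := by
      have h2 := (abs_le.mp (Real.abs_exp_sub_one_sub_id_le (x := 6 * (k * s))
        (by rw [abs_of_nonneg (by positivity)]; linarith))).2
      have h3 : 0 ≤ 6 * (k * s) := by positivity
      nlinarith
    have h4 : N * ℓ / d ≤ N / 4 := by
      rw [div_le_iff₀ hdpos]
      nlinarith [h.d_ge]
    have h5 : 0 ≤ N * ℓ / d := by positivity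
    calc a ≤ _ := ha_le
      _ ≤ 1 * (N / 4) * 2 := by
          refine mul_le_mul (mul_le_mul (by linarith) h4 h5 zero_le_one) h1
            (Real.exp_nonneg _) (by positivity)
      _ = N / 2 := by ring
  have hκ : (p + p ^ 2) * N / d ≤ exp (2 * p) := by
    have h1 : p * N ≤ d * (1 + p) := by
      have := h.d_eq
      nlinarith
    calc (p + p ^ 2) * N / d = (1 + p) * (p * N / d) := by ring
      _ ≤ (1 + p) * (1 + p) := by
          refine mul_le_mul_of_nonneg_left ?_ (by linarith)
          rw [div_le_iff₀ hdpos]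
          linarith
      _ ≤ exp p * exp p := by
          have := Real.add_one_le_exp p
          exact mul_le_mul (by linarith) (by linarith) (by linarith) (Real.exp_nonneg _)
      _ = _ := by rw [← Real.exp_add]; ring_nf
  have hκa : (p + p ^ 2) * a ≤ (η - ε / 2) * ℓ := by
    have h1 : exp (2 * p) * exp (6 * (k * s)) ≤ 1 + ε / 2 := by
      rw [← Real.exp_add]
      have h2 : exp (2 * p + 6 * (k * s)) ≤ exp (ε / 4) := by
        refine Real.exp_le_exp.mpr ?_
        linarith [h.p_small]
      have h3 := (abs_le.mp (Real.abs_exp_sub_one_sub_id_le (x := ε / 4)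
        (by rw [abs_of_nonneg] <;> linarith))).2
      nlinarith
    calc (p + p ^ 2) * a ≤ (p + p ^ 2) * ((η - ε) * (N * ℓ / d) * exp (6 * (k * s))) :=
          mul_le_mul_of_nonneg_left ha_le (by positivity)
      _ = (η - ε) * ℓ * ((p + p ^ 2) * N / d * exp (6 * (k * s))) := by ring
      _ ≤ (η - ε) * ℓ * (1 + ε / 2) := by
          refine mul_le_mul_of_nonneg_left ?_ (mul_nonneg (by linarith) (by linarith))
          exact (mul_le_mul_of_nonneg_right hκ (Real.exp_nonneg _)).trans h1
      _ = ((η - ε) * (1 + ε / 2)) * ℓ := by ring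
      _ ≤ _ := mul_le_mul_of_nonneg_right (by nlinarith) (by linarith)
  calc exp (ε * ℓ / 2) / (2 * ρ) = N / 2 * (exp (ε * ℓ / 2) / exp (η * ℓ)) := by
        rw [h.eta_eq, ← h.rho_eq]
        field_simp
    _ = N / 2 * exp (-((η - ε / 2) * ℓ)) := by
        rw [← Real.exp_sub]
        ring_nf
    _ ≤ _ := mul_le_mul (by linarith) (Real.exp_le_exp.mpr (by linarith))
        (Real.exp_nonneg _) (by linarith)

end ParamBounds

end Numerics

section Combination

namespace ParamBounds

variable {k : ℕ} {N p d ℓ s ρ ε η : ℝ}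

theorem exp_neg_log_le (h : ParamBounds k N p d ℓ s ρ ε η) : exp (-ℓ) ≤ 1 / ℓ := by
  rw [Real.exp_neg, ← one_div]
  exact one_div_le_one_div_of_le (by linarith [h.ten_le]) (by linarith [Real.add_one_le_exp ℓ])

theorem mul_exp_degree_le (h : ParamBounds k N p d ℓ s ρ ε η) :
    N * exp (-((3 * s) ^ 2 * d / 4)) ≤ 1 / ℓ := by
  refine le_trans ?_ h.exp_neg_log_le
  rw [← h.exp_log, ← Real.exp_add]
  refine Real.exp_le_exp.mpr ?_
  linarith [h.s_sq, h.ten_le]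

theorem sq_mul_exp_far_le (h : ParamBounds k N p d ℓ s ρ ε η) :
    N ^ 2 * exp (-(p * (d * (1 - (3 * s + 2 ^ (k + 2) * ρ))) ^ (k + 1))) / exp (ε * ℓ / 4) ≤
      1 / ℓ := by
  have hℓ := h.ten_le
  have h1 : (1 : ℝ) / ℓ = exp (-Real.log ℓ) := by
    rw [Real.exp_neg, Real.exp_log (by linarith), one_div]
  rw [h1, ← h.exp_log, ← Real.exp_nat_mul, ← Real.exp_add, ← Real.exp_sub]
  refine Real.exp_le_exp.mpr ?_
  push_cast
  linarith [h.far_exponent, h.loglog_le]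

theorem choose_mul_exp_le {n r : ℕ} (h : ParamBounds k n p d ℓ s ρ ε η)
    (hr : r ≤ (η - ε) * (n * ℓ / d ^ (k + 1))) :
    n.choose r * exp (-(exp (ε * ℓ / 2) / (2 * ρ) / 8)) ≤ 1 / ℓ := by
  have hℓ := h.ten_le
  have hρ := h.rho_pos
  have hρ1 := h.rho_small
  have hN := h.hN
  have hNρ : (n : ℝ) * ℓ / d ^ (k + 1) = ℓ / ρ := by
    rw [← h.rho_eq]
    field_simp
  have hr1 : r ≤ ℓ / ρ := by
    rw [hNρ] at hr
    have : 0 ≤ ℓ / ρ := by positivity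
    nlinarith [h.eta_le, h.eps_pos]
  have hν : ℓ ^ 4 / (16 * ρ) ≤ exp (ε * ℓ / 2) / (2 * ρ) / 8 := by
    have : ℓ ^ 4 ≤ exp (ε * ℓ / 2) := by
      rw [h.loglog_eq]
      refine Real.exp_le_exp.mpr ?_
      push_cast
      linarith [h.loglog_le]
    calc ℓ ^ 4 / (16 * ρ) ≤ exp (ε * ℓ / 2) / (16 * ρ) := by gcongr
      _ = _ := by ring
  have hmain : r * ℓ + ℓ ≤ ℓ ^ 4 / (16 * ρ) := by
    have h1 : r * ℓ ≤ ℓ / ρ * ℓ := mul_le_mul_of_nonneg_right hr1 (by linarith)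
    have h2 : ℓ / ρ * ℓ + ℓ ≤ ℓ ^ 4 / (16 * ρ) := by
      rw [le_div_iff₀ (by positivity)]
      have : (ℓ / ρ * ℓ + ℓ) * (16 * ρ) = 16 * ℓ ^ 2 + 16 * (ℓ * ρ) := by field_simp
      rw [this]
      have h3 : 100 * ℓ ^ 2 ≤ ℓ ^ 4 := by
        have : 100 ≤ ℓ ^ 2 := by nlinarith
        nlinarith
      have h4 : ℓ * ρ ≤ ℓ ^ 2 := by nlinarith
      nlinarith [sq_nonneg ℓ]
    linarith
  refine le_trans ?_ h.exp_neg_log_le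
  have hchoose : (n.choose r : ℝ) ≤ exp (r * ℓ) := by
    rw [Real.exp_nat_mul, h.exp_log]
    exact_mod_cast Nat.choose_le_pow n r
  calc n.choose r * exp (-(exp (ε * ℓ / 2) / (2 * ρ) / 8))
      ≤ exp (r * ℓ) * exp (-(exp (ε * ℓ / 2) / (2 * ρ) / 8)) := by gcongr
    _ = exp (r * ℓ + -(exp (ε * ℓ / 2) / (2 * ρ) / 8)) := (Real.exp_add _ _).symm
    _ ≤ exp (-ℓ) := Real.exp_le_exp.mpr (by linarith)

theorem twin_threshold (h : ParamBounds k N p d ℓ s ρ ε η) :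
    exp (ε * ℓ / 4) + 2 ≤ exp (ε * ℓ / 2) / (2 * ρ) / 2 := by
  have hℓ := h.ten_le
  have hρ := h.rho_pos
  have hK : 6 ≤ exp (ε * ℓ / 4) := by
    have : ℓ ^ 2 ≤ exp (ε * ℓ / 4) := by
      rw [h.loglog_eq]
      refine Real.exp_le_exp.mpr ?_
      push_cast
      linarith [h.loglog_le]
    nlinarith
  have hsq : exp (ε * ℓ / 2) = exp (ε * ℓ / 4) ^ 2 := by
    rw [← Real.exp_nat_mul]
    ring_nf
  rw [hsq, div_div, le_div_iff₀ (by positivity)]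
  have := h.rho_small
  nlinarith

/-- Under `ParamBounds` the failure probability is `O(1 / log n)`. -/
theorem bernProb_hasTwins {n r : ℕ} (h : ParamBounds k n p d ℓ s ρ ε η)
    (hr : r ≤ (η - ε) * (n * ℓ / d ^ (k + 1))) :
    1 - (k + 4) / ℓ ≤ bernProb p {ω : EdgeIdx (Fin n) → Bool |
      ∀ R : Finset (Fin n), R.card = r → HasTwins (graphOf ω) R (k + 1 + 1)} := by
  have hd := h.d_pos
  have hs := h.s_small
  have hε := h.eps_le
  have hs0 := h.s_nonneg
  have hℓ := h.ten_le
  have hp := h.p_nonneg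
  have hγ := h.gamma_le
  have hu := h.uncovered rfl
  set γ := 3 * s + 2 ^ (k + 2) * ρ with hγdef
  have key := bernProb_hasTwins_ge (V := Fin n) (p := p) (δ := 3 * s) (d := d) (m := d / 2)
    (κ := p + p ^ 2) (a := (η - ε) * (n * ℓ / d ^ (k + 1)) * (1 + (1 + 3 * s) * d) ^ k)
    (ν := exp (ε * ℓ / 2) / (2 * ρ)) (K := exp (ε * ℓ / 4)) (k := k) (r := r)
    (L := fun j => (d * (1 - γ)) ^ j)
    (μ := fun j => (n - (1 + (1 + 3 * s) * d) ^ j) * (1 - exp (-(p * (d * (1 - γ)) ^ j))))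
    hp (by linarith [h.p_small]) (by linarith) (by linarith) (by linarith)
    (by rw [Fintype.card_fin, h.d_eq]; linarith)
    (fun j => pow_nonneg (mul_nonneg (by linarith) (by linarith)) j) (by simp) (by linarith)
    (fun j _ => by rw [Fintype.card_fin]) (fun j hj => (h.sphere_growth hj).2)
    (fun j hj => (h.sphere_growth hj).1) (by positivity) h.exp_neg_kappa_le
    (mul_le_mul_of_nonneg_right hr (by positivity)) (by rwa [Fintype.card_fin])
    (Real.exp_pos _) h.twin_threshold
  rw [Fintype.card_fin] at key
  have e1 := h.mul_exp_degree_le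
  have e2 : (n : ℝ) * (k + 1) * exp (-((3 * s) ^ 2 * (d / 2) / 2)) ≤ (k + 1) * (1 / ℓ) := by
    calc (n : ℝ) * (k + 1) * exp (-((3 * s) ^ 2 * (d / 2) / 2))
        = (k + 1) * (n * exp (-((3 * s) ^ 2 * d / 4))) := by ring_nf
      _ ≤ _ := by gcongr
  have e3 := h.sq_mul_exp_far_le
  have e4 := h.choose_mul_exp_le hr
  have e5 : ((k : ℝ) + 4) / ℓ = 1 / ℓ + (k + 1) * (1 / ℓ) + 1 / ℓ + 1 / ℓ := by ring
  rw [e5]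
  linarith

end ParamBounds

end Combination
section Asymptotic

theorem Asymptotics.IsLittleO.eventually_mul_le {f g : ℕ → ℝ} (h : f =o[atTop] g)
    (hg : ∀ᶠ n in atTop, 0 < g n) {C : ℝ} (hC : 0 < C) : ∀ᶠ n in atTop, C * f n ≤ g n := by
  filter_upwards [h.bound (inv_pos.mpr hC), hg] with n hn hgn
  rw [Real.norm_of_nonneg hgn.le] at hn
  have h1 := mul_le_mul_of_nonneg_left ((le_abs_self _).trans hn) hC.le
  rwa [mul_inv_cancel_left₀ hC.ne'] at h1

/-- The asymptotic hypotheses on `p`, `d`, `η`, `ε` yield `ParamBounds` for all large `n`. -/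
theorem eventually_paramBounds {p d η ε : ℕ → ℝ} {k : ℕ}
    (hp : ∀ n, 0 ≤ p n ∧ p n ≤ 1)
    (hd : ∀ n, d n = p n * ((n : ℝ) - 1))
    (hd_lower : Tendsto (fun n : ℕ => d n / Real.log n) atTop atTop)
    (hi : (fun n : ℕ => d n ^ (k + 1)) =o[atTop] (fun n : ℕ => (n : ℝ)))
    (hc : Tendsto (fun n : ℕ => d n ^ (k + 1 + 1) / n - 2 * Real.log n) atTop atTop)
    (hη : ∀ n : ℕ, η n = Real.log (d n ^ (k + 1)) / Real.log n)
    (hε0 : Tendsto ε atTop (𝓝 0))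
    (hε_pos : ∀ᶠ n : ℕ in atTop, 0 < ε n)
    (hε1 : (fun n : ℕ => 1 / Real.sqrt (d n / Real.log n)) =o[atTop] ε)
    (hε2 : (fun n : ℕ => d n / n) =o[atTop] ε)
    (hε3 : (fun n : ℕ => Real.log (Real.log n) / Real.log n) =o[atTop] ε) :
    ∀ᶠ n : ℕ in atTop, ParamBounds k n (p n) (d n) (Real.log n)
      (1 / Real.sqrt (d n / Real.log n)) (d n ^ (k + 1) / n) (ε n) (η n) := by
  have hlog : Tendsto (fun n : ℕ => Real.log n) atTop atTop :=
    Real.tendsto_log_atTop.comp tendsto_natCast_atTop_atTop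
  have hn0 : ∀ᶠ n : ℕ in atTop, (0 : ℝ) < n :=
    (tendsto_natCast_atTop_atTop (R := ℝ)).eventually_gt_atTop 0
  filter_upwards [eventually_ge_atTop 2, hlog.eventually_ge_atTop 10,
    hd_lower.eventually_ge_atTop 4, hε_pos, hε0.eventually (eventually_le_nhds one_half_pos),
    hε1.eventually_mul_le hε_pos (C := 96 * (k + 1) * 2 ^ (k + 2)) (by positivity),
    hi.eventually_mul_le hn0 (C := 96 * (k + 1) * 2 ^ (k + 2)) (by positivity),
    hε2.eventually_mul_le hε_pos (C := 64) (by norm_num),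
    hε3.eventually_mul_le hε_pos (C := 8) (by norm_num),
    hc.eventually_ge_atTop 0] with n hn hℓ hdℓ hε hε' hs hρ hdn hll hcn
  have hn0 : (0 : ℝ) < n := by positivity
  have hℓ0 : 0 < Real.log n := by linarith
  have hd4 : 4 * Real.log n ≤ d n := (le_div_iff₀ hℓ0).mp hdℓ
  have hd0 : 0 < d n := by linarith
  exact
    { hN := by exact_mod_cast hn
      p_nonneg := (hp n).1
      d_eq := hd n
      exp_log := Real.exp_log hn0
      ten_le := hℓ
      d_ge := hd4
      s_nonneg := by positivity
      s_sq := by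
        rw [div_pow, Real.sq_sqrt (by positivity)]
        field_simp
      rho_eq := by field_simp
      eps_pos := hε
      eps_le := hε'
      s_le := hs
      rho_le := by
        rw [← mul_div_assoc]
        exact (div_le_one hn0).mpr hρ
      d_le := by
        rw [← mul_div_assoc] at hdn
        exact (div_le_iff₀ hn0).mp hdn
      loglog_le := by
        rw [← mul_div_assoc] at hll
        exact (div_le_iff₀ hℓ0).mp hll
      c_ge := by
        have : d n * (d n ^ (k + 1) / n) = d n ^ (k + 1 + 1) / n := by ring
        rw [this]
        linarith
      eta_eq := by
        rw [hη, div_mul_cancel₀ _ hℓ0.ne', Real.exp_log (by positivity)] }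

end Asymptotic

/-- Core of the proof of Theorem 4.3: a.a.s. for every set `R` of cardinality
`r = (η−ε)·n·log n/d^i` there are two distinct vertices at distance exactly `i+1`
from every vertex of `R`; in particular no such `R` is a resolving set. -/
theorem stmt_17 (p d c η ε : ℕ → ℝ) (i : ℕ) (r : ℕ → ℕ)
    (hp : ∀ n, 0 ≤ p n ∧ p n ≤ 1)
    (hd : ∀ n, d n = p n * ((n : ℝ) - 1))
    (hd_lower : Tendsto (fun n : ℕ => d n / Real.log n) atTop atTop)
    (hd_upper : (fun n : ℕ => d n) =o[atTop] (fun n : ℕ => (n : ℝ)))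
    (hi1 : 1 ≤ i)
    (hi : (fun n : ℕ => d n ^ i) =o[atTop] (fun n : ℕ => (n : ℝ)))
    (hi_max : ∀ j : ℕ, ((fun n : ℕ => d n ^ j) =o[atTop] (fun n : ℕ => (n : ℝ))) → j ≤ i)
    (hc : ∀ n : ℕ, c n = d n ^ (i + 1) / n)
    (hc_big : Tendsto (fun n : ℕ => c n - 2 * Real.log n) atTop atTop)
    (hη : ∀ n : ℕ, η n = Real.log (d n ^ i) / Real.log n)
    (hε0 : Tendsto ε atTop (𝓝 0))
    (hε_pos : ∀ᶠ n : ℕ in atTop, 0 < ε n)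
    (hε1 : (fun n : ℕ => 1 / Real.sqrt (d n / Real.log n)) =o[atTop] ε)
    (hε2 : (fun n : ℕ => d n / n) =o[atTop] ε)
    (hε3 : (fun n : ℕ => Real.log (Real.log n) / Real.log n) =o[atTop] ε)
    (hr : ∀ n : ℕ, r n = ⌊(η n - ε n) * ((n : ℝ) * Real.log n / d n ^ i)⌋₊) :
    Tendsto (fun n : ℕ => gnpProb n (p n)
      {G : SimpleGraph (Fin n) | ∀ R : Finset (Fin n), R.card = r n →
        (∃ u v : Fin n, u ≠ v ∧
          (∀ w ∈ R, G.Reachable w u ∧ G.dist w u = i + 1) ∧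
          (∀ w ∈ R, G.Reachable w v ∧ G.dist w v = i + 1)) ∧
        ¬ Resolves G ↑R}) atTop (𝓝 1) := by
  obtain ⟨k, rfl⟩ : ∃ k, i = k + 1 := ⟨i - 1, by omega⟩
  have hlog : Tendsto (fun n : ℕ => Real.log n) atTop atTop :=
    Real.tendsto_log_atTop.comp tendsto_natCast_atTop_atTop
  have hlow : Tendsto (fun n : ℕ => 1 - ((k : ℝ) + 4) / Real.log n) atTop (𝓝 1) := by
    simpa using tendsto_const_nhds.sub (hlog.const_div_atTop ((k : ℝ) + 4))
  simp only [hc] at hc_big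
  refine tendsto_of_tendsto_of_tendsto_of_le_of_le' hlow tendsto_const_nhds ?_ ?_
  · filter_upwards [eventually_paramBounds hp hd hd_lower hi hc_big hη hε0 hε_pos hε1 hε2 hε3]
      with n h
    rw [gnpProb_eq_bernProb]
    refine h.bernProb_hasTwins ?_
    rw [hr]
    have hℓ := h.ten_le
    have hd0 := h.d_pos
    exact Nat.floor_le (mul_nonneg (by linarith [h.eps_le_eta]) (by positivity))
  · refine Eventually.of_forall fun n => ?_
    rw [gnpProb_eq_bernProb]
    exact bernProb_le_one (hp n).1 (hp n).2 _
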